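/- Let d ≥ 1, let f : [0,1]^d → ℝ, and let u ∈ X_4^d satisfy Δu = f on (0,1)^d and u = 0 on ∂[0,1]^d; set K = sup{‖D^α u‖_∞ : α ∈ {0,…,4}^d}. For each level vector i ∈ ℕ^d, let u_{2^{−i}} denote the multilinear interpolant of the central finite difference solution of the Poisson problem on the grid with mesh sizes h_k = 2^{−i_k}. Define the sparse grid combination solution at level n ≥ d−1 by u_n = Σ_{k=0}^{d−1} (−1)^k · binom(d−1, k) · Σ_{i∈ℕ^d, |i|_1 = n−k} u_{2^{−i}}. Then for every x ∈ [0,1]^d: |u(x) − u_n(x)| ≤ 121000 · K · d · (5/2)^d · (n+2(d−1))^{d−1} · 4^{−n}. -/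

import Mathlib

/-- Partial derivative of `u` in direction `i` (one-sided within `[0,1]` at the
boundary): `∂ᵢu(x) = d/dt u(x₁,…,t,…,x_d)|_{t = xᵢ}` taken within `[0,1]`. -/
noncomputable def pd (d : ℕ) (i : Fin d) (u : (Fin d → ℝ) → ℝ) : (Fin d → ℝ) → ℝ :=
  fun x => derivWithin (fun t => u (Function.update x i t)) (Set.Icc 0 1) (x i)

/-- Mixed partial derivative `D^α u = ∂₁^{α₁} ⋯ ∂_d^{α_d} u`. -/
noncomputable def mderiv (d : ℕ) (α : Fin d → ℕ) (u : (Fin d → ℝ) → ℝ) :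
    (Fin d → ℝ) → ℝ :=
  (List.finRange d).foldr (fun i v => (pd d i)^[α i] v) u

/-- The closed unit cube `[0,1]^d`. -/
def unitCube (d : ℕ) : Set (Fin d → ℝ) := Set.Icc 0 1

/-- The open unit cube `(0,1)^d`. -/
def openCube (d : ℕ) : Set (Fin d → ℝ) := Set.pi Set.univ fun _ => Set.Ioo (0 : ℝ) 1

/-- The boundary `∂[0,1]^d`. -/
def cubeBdry (d : ℕ) : Set (Fin d → ℝ) := {x ∈ unitCube d | ∃ i, x i = 0 ∨ x i = 1}

/-- All mixed partial derivatives `D^β f`, `β ≤ α`, exist on `s` (each step of the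
iterated differentiation is differentiable within `[0,1]` in its direction). -/
def HasDerivsOn (d : ℕ) (α : Fin d → ℕ) (f : (Fin d → ℝ) → ℝ)
    (s : Set (Fin d → ℝ)) : Prop :=
  ∀ β : Fin d → ℕ, (∀ i, β i ≤ α i) → ∀ i : Fin d, β i < α i → ∀ x ∈ s,
    DifferentiableWithinAt ℝ (fun t => mderiv d β f (Function.update x i t))
      (Set.Icc 0 1) (x i)

/-- `u ∈ X_k^d`: all mixed derivatives `D^α u`, `α ∈ {0,…,k}^d`, exist, are
continuous on `[0,1]^d` and vanish on the boundary. -/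
def MemX (d k : ℕ) (u : (Fin d → ℝ) → ℝ) : Prop :=
  HasDerivsOn d (fun _ => k) u (unitCube d) ∧
  ∀ α : Fin d → ℕ, (∀ i, α i ≤ k) →
    ContinuousOn (mderiv d α u) (unitCube d) ∧
    ∀ x ∈ cubeBdry d, mderiv d α u x = 0

/-- `u ∈ X_k^d(K)`: additionally all these derivatives are bounded by `K`. -/
def MemXb (d k : ℕ) (K : ℝ) (u : (Fin d → ℝ) → ℝ) : Prop :=
  MemX d k u ∧
  ∀ α : Fin d → ℕ, (∀ i, α i ≤ k) → ∀ x ∈ unitCube d, |mderiv d α u x| ≤ K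

/-- Mesh size `h_k = 2^{-lvl_k}` attached to a level vector. -/
noncomputable def hmesh (d : ℕ) (lvl : Fin d → ℕ) (k : Fin d) : ℝ := ((2 : ℝ) ^ lvl k)⁻¹

/-- The grid point with index `i` on the grid of level `lvl`. -/
noncomputable def gridpt (d : ℕ) (lvl : Fin d → ℕ) (i : Fin d → ℕ) : Fin d → ℝ :=
  fun k => (i k : ℝ) * hmesh d lvl k

/-- Valid grid indices: `0 ≤ i_k ≤ 2^{lvl_k}`. -/
def IsGridIdx (d : ℕ) (lvl : Fin d → ℕ) (i : Fin d → ℕ) : Prop := ∀ k, i k ≤ 2 ^ lvl k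

/-- The hyperplane set `I^{(J)} = {x ∈ [0,1]^d : x_j/h_j ∈ ℤ for j ∈ J}`. -/
def Iplane (d : ℕ) (J : Finset (Fin d)) (lvl : Fin d → ℕ) : Set (Fin d → ℝ) :=
  {x ∈ unitCube d | ∀ j ∈ J, ∃ m : ℤ, x j = (m : ℝ) * hmesh d lvl j}

/-- `U` is the central finite difference solution of the Poisson problem `Δu = f`
with zero Dirichlet data on the grid of level `lvl`. -/
def IsFDPoisson (d : ℕ) (lvl : Fin d → ℕ) (f : (Fin d → ℝ) → ℝ)
    (U : (Fin d → ℕ) → ℝ) : Prop :=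
  (∀ i : Fin d → ℕ, IsGridIdx d lvl i → (∃ k, i k = 0 ∨ i k = 2 ^ lvl k) → U i = 0) ∧
  (∀ i : Fin d → ℕ, (∀ k, 1 ≤ i k ∧ i k < 2 ^ lvl k) →
    ∑ k, (U (Function.update i k (i k + 1)) - 2 * U i + U (Function.update i k (i k - 1)))
        / hmesh d lvl k ^ 2
      = f (gridpt d lvl i))

/-- `U` is the upwind (implicit Euler) solution of the advection equation
`Σᵢ ∂ᵢu = 0` on the grid of level `lvl`, with inflow data given by `u`. -/
def IsUpwindSol (d : ℕ) (lvl : Fin d → ℕ) (u : (Fin d → ℝ) → ℝ)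
    (U : (Fin d → ℕ) → ℝ) : Prop :=
  (∀ i : Fin d → ℕ, IsGridIdx d lvl i → (∃ k, i k = 0) → U i = u (gridpt d lvl i)) ∧
  (∀ i : Fin d → ℕ, IsGridIdx d lvl i → (∀ k, 1 ≤ i k) →
    ∑ k, (U i - U (Function.update i k (i k - 1))) / hmesh d lvl k = 0)

/-- `g` is the multilinear interpolant of the grid function `U` on the grid of
level `lvl`: it agrees with `U` at all grid points and is a polynomial of degree
at most `1` in each variable on each grid cell. -/
def IsInterp (d : ℕ) (lvl : Fin d → ℕ) (U : (Fin d → ℕ) → ℝ)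
    (g : (Fin d → ℝ) → ℝ) : Prop :=
  (∀ i : Fin d → ℕ, IsGridIdx d lvl i → g (gridpt d lvl i) = U i) ∧
  (∀ j : Fin d → ℕ, (∀ k, j k < 2 ^ lvl k) →
    ∃ c : Finset (Fin d) → ℝ, ∀ x : Fin d → ℝ,
      (∀ k, (j k : ℝ) * hmesh d lvl k ≤ x k ∧ x k ≤ ((j k : ℝ) + 1) * hmesh d lvl k) →
      g x = ∑ T : Finset (Fin d), c T * ∏ k ∈ T, x k)

/-- The domain `{x : x ± h e_k ∈ [0,1]^d}` of the truncation error terms. -/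
def diffDom (d : ℕ) (k : Fin d) (h : ℝ) : Set (Fin d → ℝ) :=
  {x | Function.update x k (x k + h) ∈ unitCube d ∧
       Function.update x k (x k - h) ∈ unitCube d}

namespace PoissonSparseGrid

open Finset

/-- The backward difference of a sequence, extended by `0` to negative indices. -/
def bdiff (a : ℕ → ℝ) : ℕ → ℝ
  | 0 => a 0
  | i + 1 => a (i + 1) - a i

lemma sum_range_bdiff (a : ℕ → ℝ) (M : ℕ) : ∑ i ∈ range (M + 1), bdiff a i = a M := by
  induction M with
  | zero => simp [bdiff]
  | succ M ih => rw [sum_range_succ, ih]; simp [bdiff]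

/-- Level vectors bounded by `M` with `|i|₁ = m`. -/
def levels (d M m : ℕ) : Finset (Fin d → ℕ) :=
  (Fintype.piFinset fun _ : Fin d => range (M + 1)).filter (fun i => ∑ j, i j = m)

lemma levels_injOn_subset (d M m : ℕ) :
    levels d M m ⊆ (finsuppAntidiag (univ : Finset (Fin d)) m).image (fun f : Fin d →₀ ℕ => (f : Fin d → ℕ)) := by
  intro i hi
  simp only [levels, mem_filter] at hi
  rw [mem_image]
  exact ⟨Finsupp.equivFunOnFinite.symm i, by simp [hi.2], by simp⟩

lemma levels_eq (d M m : ℕ) (h : m ≤ M) :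
    levels d M m = (finsuppAntidiag (univ : Finset (Fin d)) m).image (fun f : Fin d →₀ ℕ => (f : Fin d → ℕ)) := by
  apply (levels_injOn_subset d M m).antisymm
  intro i hi
  rw [mem_image] at hi
  obtain ⟨f, hf, rfl⟩ := hi
  simp only [mem_finsuppAntidiag] at hf
  simp only [levels, mem_filter, Fintype.mem_piFinset, mem_range]
  refine ⟨fun a => ?_, hf.1⟩
  have : f a ≤ ∑ j, f j := single_le_sum (fun _ _ => Nat.zero_le _) (mem_univ a)
  have h2 := hf.1
  change ∑ j, f j = m at h2
  omega

lemma sum_levels_prod (d M m : ℕ) (h : m ≤ M) (a : Fin d → ℕ → ℝ) :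
    ∑ i ∈ levels d M m, ∏ l, a l (i l) =
      PowerSeries.coeff m (∏ l, PowerSeries.mk (a l)) := by
  rw [levels_eq d M m h, sum_image (fun f _ g _ hfg => DFunLike.coe_injective (F := Fin d →₀ ℕ) hfg),
    PowerSeries.coeff_prod]
  simp

lemma mk_bdiff (a : ℕ → ℝ) :
    PowerSeries.mk (bdiff a) = (1 - PowerSeries.X) * PowerSeries.mk a := by
  ext n
  cases n with
  | zero => simp [bdiff, sub_mul]
  | succ n => simp [bdiff, sub_mul, PowerSeries.coeff_succ_X_mul]

lemma sum_coeff_one_sub_X_mul (P : PowerSeries ℝ) (n : ℕ) :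
    ∑ m ∈ range (n + 1), PowerSeries.coeff m ((1 - PowerSeries.X) * P) =
      PowerSeries.coeff n P := by
  induction n with
  | zero => simp [sub_mul]
  | succ n ih => rw [sum_range_succ, ih]; simp [sub_mul, PowerSeries.coeff_succ_X_mul]

/-- The combination formula is the sum of all tensor-product differences of total level `≤ n`. -/
lemma combination_formula (d n : ℕ) (hd : 1 ≤ d) (hn : d - 1 ≤ n) (a : Fin d → ℕ → ℝ) :
    ∑ k ∈ range d, (-1 : ℝ) ^ k * (Nat.choose (d - 1) k : ℝ) *
        ∑ i ∈ levels d n (n - k), ∏ l, a l (i l) =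
      ∑ m ∈ range (n + 1), ∑ i ∈ levels d n m, ∏ l, bdiff (a l) (i l) := by
  obtain ⟨e, rfl⟩ : ∃ e, d = e + 1 := ⟨d - 1, by omega⟩
  set P : PowerSeries ℝ := ∏ l, PowerSeries.mk (a l) with hP
  have h1 : ∑ m ∈ range (n + 1), ∑ i ∈ levels (e + 1) n m, ∏ l, bdiff (a l) (i l) =
      PowerSeries.coeff n ((1 - PowerSeries.X) ^ e * P) := by
    rw [← sum_coeff_one_sub_X_mul]
    refine sum_congr rfl fun m hm => ?_
    rw [sum_levels_prod (e + 1) n m (by simpa [Nat.lt_succ_iff] using hm)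
      (fun l => bdiff (a l))]
    simp only [mk_bdiff, prod_mul_distrib, prod_const, card_univ, Fintype.card_fin]
    rw [← hP, pow_succ']
    ring_nf
  rw [h1, sub_eq_neg_add, add_pow, sum_mul, map_sum]
  refine sum_congr rfl fun k hk => ?_
  have hk' : k ≤ n := by
    rw [mem_range] at hk; omega
  rw [sum_levels_prod _ n (n - k) (by omega)]
  have h2 : (-PowerSeries.X : PowerSeries ℝ) ^ k * 1 ^ (e - k) * ((e.choose k : ℕ) : PowerSeries ℝ) * P
      = PowerSeries.C ((-1 : ℝ) ^ k * (e.choose k : ℝ)) * (PowerSeries.X ^ k * P) := by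
    rw [neg_pow]
    simp only [map_mul, map_pow, map_neg, map_one, map_natCast, one_pow]
    ring
  rw [h2, PowerSeries.coeff_C_mul]
  conv_rhs => rw [show n = (n - k) + k by omega, PowerSeries.coeff_X_pow_mul]
  simp [hP]

lemma sum_box_split (d M : ℕ) (g : (Fin d → ℕ) → ℝ) :
    ∑ i ∈ Fintype.piFinset (fun _ : Fin d => range (M + 1)), g i =
      ∑ m ∈ range (d * M + 1), ∑ i ∈ levels d M m, g i := by
  symm
  apply sum_fiberwise_of_maps_to
  intro i hi
  rw [Fintype.mem_piFinset] at hi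
  have : ∑ j, i j ≤ ∑ _j : Fin d, M := sum_le_sum fun j _ => by
    have := hi j; rw [mem_range] at this; omega
  simp at this
  simp; omega

lemma levels_mono_eq (d n M m : ℕ) (h : m ≤ n) (hM : n ≤ M) : levels d n m = levels d M m := by
  rw [levels_eq d n m h, levels_eq d M m (h.trans hM)]

lemma card_levels_le (d M m : ℕ) (hd : 1 ≤ d) :
    ((levels d M m).card : ℝ) ≤ ((m : ℝ) + (d - 1 : ℕ)) ^ (d - 1) / ((d - 1).factorial : ℝ) := by
  have h1 : (levels d M m).card ≤ (m + (d - 1)).choose (d - 1) := by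
    classical
    refine (card_le_card (levels_injOn_subset d M m)).trans (card_image_le.trans ?_)
    rw [card_finsuppAntidiag_nat_eq_choose]
    simp only [card_univ, Fintype.card_fin]
    rw [show d + m - 1 = m + (d - 1) by omega, Nat.choose_symm_add]
  calc ((levels d M m).card : ℝ) ≤ ((m + (d - 1)).choose (d - 1) : ℕ) := by exact_mod_cast h1
    _ ≤ ((m + (d - 1) : ℕ) : ℝ) ^ (d - 1) / ((d - 1).factorial : ℝ) := Nat.choose_le_pow_div _ _
    _ = _ := by push_cast; rfl

lemma add_pow_le_two_pow (n e r : ℕ) (hn : e ≤ n) :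
    ((n : ℝ) + r + e) ^ e ≤ ((n : ℝ) + 2 * e) ^ e * 2 ^ r := by
  rcases Nat.eq_zero_or_pos e with rfl | he
  · simpa using one_le_pow₀ (by norm_num : (1 : ℝ) ≤ 2)
  have he' : (0 : ℝ) < e := by exact_mod_cast he
  have hn' : (e : ℝ) ≤ n := by exact_mod_cast hn
  have hr : (0 : ℝ) ≤ r := by positivity
  have h1 : (n : ℝ) + r + e ≤ (n + 2 * e) * (1 + r / (3 * e)) := by
    have : (r : ℝ) ≤ (n + 2 * e) * (r / (3 * e)) := by
      rw [mul_div_assoc', le_div_iff₀ (by positivity)]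
      nlinarith
    nlinarith
  have h2 : 1 + (r : ℝ) / (3 * e) ≤ Real.exp (r / (3 * e)) := by
    have := Real.add_one_le_exp ((r : ℝ) / (3 * e)); linarith
  have h3 : Real.exp ((r : ℝ) / (3 * e)) ^ e ≤ 2 ^ r := by
    rw [← Real.exp_nat_mul, show (e : ℝ) * (r / (3 * e)) = r * (1 / 3) by field_simp,
      Real.exp_nat_mul]
    apply pow_le_pow_left₀ (Real.exp_pos _).le
    have h4 : Real.exp (1 / 3) ≤ Real.exp (Real.log 2) := by
      apply Real.exp_le_exp.2
      linarith [Real.log_two_gt_d9]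
    rwa [Real.exp_log (by norm_num)] at h4
  calc ((n : ℝ) + r + e) ^ e ≤ ((n + 2 * e) * (1 + r / (3 * e))) ^ e :=
        pow_le_pow_left₀ (by positivity) h1 _
    _ = (n + 2 * e) ^ e * (1 + r / (3 * e)) ^ e := mul_pow _ _ _
    _ ≤ (n + 2 * e) ^ e * 2 ^ r := by
        gcongr
        exact (pow_le_pow_left₀ (by positivity) h2 _).trans h3

/-- Tail sum of `4^{-|i|₁}` over level vectors with `|i|₁ > n`. -/
lemma tail_sum_le (d n M : ℕ) (hd : 1 ≤ d) (hn : d - 1 ≤ n) (T : ℕ) :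
    ∑ m ∈ Ico (n + 1) T, ∑ _i ∈ levels d M m, ((4 : ℝ) ^ m)⁻¹ ≤
      ((n : ℝ) + 2 * ((d : ℝ) - 1)) ^ (d - 1) / ((d - 1).factorial : ℝ) * ((4 : ℝ) ^ n)⁻¹ := by
  obtain ⟨e, rfl⟩ : ∃ e, d = e + 1 := ⟨d - 1, by omega⟩
  simp only [Nat.add_sub_cancel] at hn ⊢
  set C : ℝ := ((n : ℝ) + 2 * e) ^ e / (e.factorial : ℝ) * ((4 : ℝ) ^ n)⁻¹ with hC
  have hC0 : 0 ≤ C := by positivity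
  have key : ∀ r : ℕ, ∑ _i ∈ levels (e + 1) M (n + 1 + r), ((4 : ℝ) ^ (n + 1 + r))⁻¹ ≤
      C * (1 / 2 * (1 / 2) ^ r) := by
    intro r
    have h1 := card_levels_le (e + 1) M (n + 1 + r) hd
    simp only [Nat.add_sub_cancel] at h1
    have h2 := add_pow_le_two_pow n e (1 + r) hn
    rw [sum_const, nsmul_eq_mul]
    calc ((levels (e + 1) M (n + 1 + r)).card : ℝ) * ((4 : ℝ) ^ (n + 1 + r))⁻¹
        ≤ (((n : ℝ) + 2 * e) ^ e * 2 ^ (1 + r)) / (e.factorial : ℝ) * ((4 : ℝ) ^ (n + 1 + r))⁻¹ := by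
          gcongr
          refine h1.trans ?_
          gcongr
          refine le_trans (le_of_eq ?_) h2
          push_cast; ring
      _ = C * (1 / 2 * (1 / 2) ^ r) := by
          rw [hC, pow_add (4 : ℝ) (n + 1) r, pow_succ, pow_add, show (4 : ℝ) ^ r = 2 ^ r * 2 ^ r by
            rw [← mul_pow]; norm_num, one_div_pow]
          field_simp
          ring
  rw [sum_Ico_eq_sum_range]
  calc _ ≤ ∑ r ∈ range (T - (n + 1)), C * (1 / 2 * (1 / 2) ^ r) := sum_le_sum fun r _ => key r
    _ = C * (1 / 2 * ∑ r ∈ range (T - (n + 1)), (1 / 2 : ℝ) ^ r) := by rw [mul_sum, mul_sum]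
    _ ≤ C * (1 / 2 * 2) := by
        gcongr
        exact sum_geometric_two_le _
    _ = C := by ring
    _ = _ := by rw [hC]; push_cast; ring_nf

lemma pow_div_factorial_const_le (d : ℕ) (hd : 1 ≤ d) :
    (16 : ℝ) ^ (d - 1) * 20 / ((d - 1).factorial : ℝ) ≤ 121000 * (5 / 2 : ℝ) ^ d := by
  obtain ⟨e, rfl⟩ : ∃ e, d = e + 1 := ⟨d - 1, by omega⟩
  simp only [Nat.add_sub_cancel]
  have h1 := Real.pow_div_factorial_le_exp (32 / 5 : ℝ) (by norm_num) e
  have h2 : Real.exp (32 / 5) ≤ 2187 := by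
    have h3 : Real.exp (32 / 5) ≤ Real.exp 1 ^ 7 := by
      rw [← Real.exp_nat_mul]; apply Real.exp_le_exp.2; norm_num
    refine h3.trans ?_
    calc Real.exp 1 ^ 7 ≤ 3 ^ 7 := pow_le_pow_left₀ (Real.exp_pos _).le
          (by linarith [Real.exp_one_lt_d9]) _
      _ = 2187 := by norm_num
  have h4 : (16 : ℝ) ^ e = (32 / 5) ^ e * (5 / 2) ^ e := by rw [← mul_pow]; norm_num
  have h5 : (16 : ℝ) ^ e * 20 / (e.factorial : ℝ) =
      ((32 / 5 : ℝ) ^ e / (e.factorial : ℝ)) * (20 * (5 / 2) ^ e) := by rw [h4]; ring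
  rw [h5, pow_succ]
  have h6 : (0 : ℝ) < (5 / 2) ^ e := by positivity
  nlinarith

end PoissonSparseGrid

namespace PoissonSparseGrid

open Set

/-- The central second difference quotient. -/
noncomputable def sndDiff (h : ℝ) (g : ℝ → ℝ) (p : ℝ) : ℝ :=
  (g (p + h) - 2 * g p + g (p - h)) / h ^ 2

/-- `G 0, …, G 4` are the successive derivatives of a function on `[0,1]`, all vanishing at the
endpoints, with `|G 4| ≤ M`. -/
structure DerivChain (M : ℝ) (G : ℕ → ℝ → ℝ) : Prop where
  deriv : ∀ k < 4, ∀ τ ∈ Icc (0 : ℝ) 1, HasDerivWithinAt (G k) (G (k + 1) τ) (Icc 0 1) τ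
  zero : ∀ k ≤ 4, G k 0 = 0
  one : ∀ k ≤ 4, G k 1 = 0
  bound : ∀ τ ∈ Icc (0 : ℝ) 1, |G 4 τ| ≤ M

lemma abs_le_of_deriv_le_pow {η η' : ℝ → ℝ} {H C : ℝ} {k : ℕ}
    (hd : ∀ s ∈ Icc 0 H, HasDerivWithinAt η (η' s) (Icc 0 H) s) (h0 : η 0 = 0)
    (hb : ∀ s ∈ Icc 0 H, |η' s| ≤ C * s ^ k) :
    ∀ s ∈ Icc 0 H, |η s| ≤ C / (k + 1) * s ^ (k + 1) := by
  have hB : ∀ x : ℝ, HasDerivAt (fun s : ℝ => C / (k + 1) * s ^ (k + 1)) (C * x ^ k) x := by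
    intro x
    refine ((hasDerivAt_pow (k + 1) x).const_mul (C / (k + 1))).congr_deriv ?_
    have : (k : ℝ) + 1 ≠ 0 := by positivity
    rw [Nat.add_sub_cancel]
    push_cast
    field_simp
  intro s hs
  have := image_norm_le_of_norm_deriv_right_le_deriv_boundary (f := η) (f' := η') (a := 0) (b := H)
    (B := fun s : ℝ => C / (k + 1) * s ^ (k + 1)) (B' := fun x => C * x ^ k)
    (fun x hx => (hd x hx).continuousWithinAt)
    (fun x hx => (hd x ⟨hx.1, hx.2.le⟩).mono_of_mem_nhdsWithin
      (Icc_mem_nhdsGE_of_mem hx)) (by simp [h0]) hB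
    (fun x hx => by simpa using hb x ⟨hx.1, hx.2.le⟩) hs
  simpa using this

namespace DerivChain

variable {M : ℝ} {G : ℕ → ℝ → ℝ}

lemma nonneg (hG : DerivChain M G) : 0 ≤ M :=
  (abs_nonneg _).trans (hG.bound 0 ⟨le_rfl, zero_le_one⟩)

lemma deriv_shift (hG : DerivChain M G) {p H : ℝ} (h0 : 0 ≤ p - H) (h1 : p + H ≤ 1) {k : ℕ}
    (hk : k < 4) {s : ℝ} (hs : s ∈ Icc 0 H) :
    HasDerivWithinAt (fun s => G k (p + s)) (G (k + 1) (p + s)) (Icc 0 H) s ∧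
    HasDerivWithinAt (fun s => G k (p - s)) (-G (k + 1) (p - s)) (Icc 0 H) s := by
  obtain ⟨hs0, hs1⟩ := hs
  constructor
  · have h2 : HasDerivWithinAt (fun s : ℝ => p + s) 1 (Icc 0 H) s :=
      ((hasDerivAt_id s).const_add p).hasDerivWithinAt
    have := (hG.deriv k hk (p + s) ⟨by linarith, by linarith⟩).comp s h2
      (fun t ht => ⟨by linarith [ht.1, ht.2], by linarith [ht.1, ht.2]⟩)
    exact this.congr_deriv (by ring)
  · have h2 : HasDerivWithinAt (fun s : ℝ => p - s) (-1) (Icc 0 H) s :=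
      ((hasDerivAt_id s).const_sub p).hasDerivWithinAt
    have := (hG.deriv k hk (p - s) ⟨by linarith, by linarith⟩).comp s h2
      (fun t ht => ⟨by linarith [ht.1, ht.2], by linarith [ht.1, ht.2]⟩)
    exact this.congr_deriv (by ring)

lemma abs_symm_sub_le (hG : DerivChain M G) {p H : ℝ} (h0 : 0 ≤ p - H) (h1 : p + H ≤ 1) :
    ∀ s ∈ Icc 0 H, |G 3 (p + s) - G 3 (p - s)| ≤ 2 * M * s := by
  have := abs_le_of_deriv_le_pow (η := fun s => G 3 (p + s) - G 3 (p - s))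
    (η' := fun s => G 4 (p + s) + G 4 (p - s)) (H := H) (C := 2 * M) (k := 0)
    (fun s hs => by
      have := (hG.deriv_shift h0 h1 (k := 3) (by norm_num) hs)
      exact (this.1.sub this.2).congr_deriv (by ring)) (by simp)
    (fun s hs => by
      have h2 := hG.bound (p + s) ⟨by linarith [hs.1, hs.2], by linarith [hs.1, hs.2]⟩
      have h3 := hG.bound (p - s) ⟨by linarith [hs.1, hs.2], by linarith [hs.1, hs.2]⟩
      have := abs_add_le (G 4 (p + s)) (G 4 (p - s))
      simp only [pow_zero]
      linarith)
  simpa using this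

lemma abs_symm_add_le (hG : DerivChain M G) {p H : ℝ} (h0 : 0 ≤ p - H) (h1 : p + H ≤ 1) :
    ∀ s ∈ Icc 0 H, |G 2 (p + s) - 2 * G 2 p + G 2 (p - s)| ≤ M * s ^ 2 := by
  have := abs_le_of_deriv_le_pow (η := fun s => G 2 (p + s) - 2 * G 2 p + G 2 (p - s))
    (η' := fun s => G 3 (p + s) - G 3 (p - s)) (H := H) (C := 2 * M) (k := 1)
    (fun s hs => by
      have := (hG.deriv_shift h0 h1 (k := 2) (by norm_num) hs)
      exact ((this.1.sub_const (2 * G 2 p)).add this.2).congr_deriv (by ring))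
    (by simp only [add_zero, sub_zero]; ring)
    (fun s hs => by simpa using hG.abs_symm_sub_le h0 h1 s hs)
  intro s hs
  convert this s hs using 1
  push_cast; ring

/-- The second difference of the second derivative is bounded by the fourth derivative. -/
lemma abs_sndDiff_two_le (hG : DerivChain M G) {p h : ℝ} (hh : 0 < h) (h0 : 0 ≤ p - h)
    (h1 : p + h ≤ 1) : |sndDiff h (G 2) p| ≤ M := by
  have := hG.abs_symm_add_le h0 h1 h ⟨hh.le, le_rfl⟩
  rw [sndDiff, abs_div, abs_of_pos (by positivity : 0 < h ^ 2), div_le_iff₀ (by positivity)]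
  exact this

/-- The truncation error of the central second difference. -/
lemma abs_sndDiff_sub_le (hG : DerivChain M G) {p h : ℝ} (hh : 0 < h) (h0 : 0 ≤ p - h)
    (h1 : p + h ≤ 1) : |sndDiff h (G 0) p - G 2 p| ≤ M * h ^ 2 / 12 := by
  have e1 := abs_le_of_deriv_le_pow (η := fun s => G 1 (p + s) - G 1 (p - s) - 2 * s * G 2 p)
    (η' := fun s => G 2 (p + s) - 2 * G 2 p + G 2 (p - s)) (H := h) (C := M) (k := 2)
    (fun s hs => by
      have h2 := (hG.deriv_shift h0 h1 (k := 1) (by norm_num) hs)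
      have h3 : HasDerivWithinAt (fun s : ℝ => 2 * s * G 2 p) (2 * G 2 p) (Icc 0 h) s := by
        simpa using (((hasDerivAt_id s).const_mul 2).mul_const (G 2 p)).hasDerivWithinAt
      exact ((h2.1.sub h2.2).sub h3).congr_deriv (by ring))
    (by simp) (hG.abs_symm_add_le h0 h1)
  have e2 := abs_le_of_deriv_le_pow
    (η := fun s => G 0 (p + s) - 2 * G 0 p + G 0 (p - s) - s ^ 2 * G 2 p)
    (η' := fun s => G 1 (p + s) - G 1 (p - s) - 2 * s * G 2 p) (H := h) (C := M / 3) (k := 3)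
    (fun s hs => by
      have h2 := (hG.deriv_shift h0 h1 (k := 0) (by norm_num) hs)
      have h3 : HasDerivWithinAt (fun s : ℝ => s ^ 2 * G 2 p) (2 * s * G 2 p) (Icc 0 h) s := by
        simpa using ((hasDerivAt_pow 2 s).mul_const (G 2 p)).hasDerivWithinAt
      exact (((h2.1.sub_const (2 * G 0 p)).add h2.2).sub h3).congr_deriv (by ring))
    (by simp only [add_zero, sub_zero]; ring)
    (fun s hs => by
      have := e1 s hs
      norm_num at this ⊢
      linarith)
  have e3 := e2 h ⟨hh.le, le_rfl⟩
  have hh2 : 0 < h ^ 2 := by positivity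
  rw [sndDiff, div_sub' hh2.ne', abs_div, abs_of_pos hh2, div_le_iff₀ hh2]
  refine e3.trans (le_of_eq ?_)
  push_cast; ring

end DerivChain

end PoissonSparseGrid

namespace PoissonSparseGrid

open Set Real

/-- Eigenvalues of the negative second difference with mesh size `1 / N`. -/
noncomputable def eig (N q : ℕ) : ℝ := 4 * (N : ℝ) ^ 2 * sin (π * q / (2 * N)) ^ 2

/-- Interior grid points of the mesh with `N` cells. -/
noncomputable def pts (N : ℕ) : Finset ℝ := (Finset.Ioo 0 N).image fun p : ℕ => (p : ℝ) / N

/-- Kernel of the semidiscrete heat semigroup with sine coefficients `c`. -/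
noncomputable def wt (N : ℕ) (c : ℕ → ℝ) (t s : ℝ) : ℝ :=
  ∑ q ∈ Finset.Ioo 0 N, 2 / (N : ℝ) * (exp (-(t * eig N q)) * c q * sin (π * q * s))

/-- Discrete sine transform. -/
noncomputable def dst (N : ℕ) (v : ℝ → ℝ) (q : ℕ) : ℝ :=
  2 / (N : ℝ) * ∑ p ∈ Finset.Ioo 0 N, v ((p : ℝ) / N) * sin (π * q * ((p : ℝ) / N))

lemma sum_pts (N : ℕ) (F : ℝ → ℝ) :
    ∑ s ∈ pts N, F s = ∑ p ∈ Finset.Ioo 0 N, F ((p : ℝ) / N) := by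
  rw [pts, Finset.sum_image]
  intro a ha b hb hab
  have hN : (N : ℝ) ≠ 0 := by
    have := (Finset.mem_Ioo.1 ha)
    have : N ≠ 0 := by omega
    exact_mod_cast this
  have : (a : ℝ) = b := by
    field_simp at hab
    exact hab
  exact_mod_cast this

lemma mem_pts {N : ℕ} {s : ℝ} : s ∈ pts N ↔ ∃ p : ℕ, 0 < p ∧ p < N ∧ (p : ℝ) / N = s := by
  simp [pts, and_assoc]

lemma mem_Ioo_of_mem_pts {N : ℕ} {s : ℝ} (hs : s ∈ pts N) : s ∈ Ioo (0 : ℝ) 1 := by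
  obtain ⟨p, h0, h1, rfl⟩ := mem_pts.1 hs
  have h0' : (0 : ℝ) < p := by exact_mod_cast h0
  have h1' : (p : ℝ) < N := by exact_mod_cast h1
  have hN : (0 : ℝ) < N := h0'.trans h1'
  exact ⟨by positivity, (div_lt_one hN).2 h1'⟩

lemma pts_two_pow_subset {i j : ℕ} (h : i ≤ j) : pts (2 ^ i) ⊆ pts (2 ^ j) := by
  intro s hs
  obtain ⟨p, h0, h1, rfl⟩ := mem_pts.1 hs
  obtain ⟨k, rfl⟩ := Nat.exists_eq_add_of_le h
  refine mem_pts.2 ⟨p * 2 ^ k, by positivity, ?_, ?_⟩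
  · rw [pow_add]
    exact Nat.mul_lt_mul_of_pos_right h1 (by positivity)
  · push_cast
    rw [pow_add]
    field_simp

lemma sum_wt_mul (N : ℕ) (c : ℕ → ℝ) (t : ℝ) (v : ℝ → ℝ) :
    ∑ s ∈ pts N, wt N c t s * v s
      = ∑ q ∈ Finset.Ioo 0 N, exp (-(t * eig N q)) * c q * dst N v q := by
  simp only [sum_pts, wt, dst, Finset.sum_mul, Finset.mul_sum]
  rw [Finset.sum_comm]
  refine Finset.sum_congr rfl fun q _ => Finset.sum_congr rfl fun p _ => ?_
  ring

lemma sum_cos_mul (N : ℕ) (θ : ℝ) : 2 * sin (θ / 2) * ∑ q ∈ Finset.range N, cos (q * θ)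
    = sin ((N - 1 / 2) * θ) + sin (θ / 2) := by
  induction N with
  | zero =>
    have : ((0 : ℝ) - 1 / 2) * θ = -(θ / 2) := by ring
    simp only [CharP.cast_eq_zero, this, sin_neg, Finset.range_zero, Finset.sum_empty, mul_zero,
      neg_add_cancel]
  | succ n ih =>
    rw [Finset.sum_range_succ, mul_add, ih]
    have e1 : ((n : ℝ) - 1 / 2) * θ = n * θ - θ / 2 := by ring
    have e2 : (((n + 1 : ℕ) : ℝ) - 1 / 2) * θ = n * θ + θ / 2 := by push_cast; ring
    rw [e1, e2, sin_sub, sin_add]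
    ring

lemma sum_cos_grid {N : ℕ} {k : ℤ} (hk0 : k ≠ 0) (hk : |k| < 2 * N) :
    2 * ∑ q ∈ Finset.range N, cos (q * (π * k / N)) = 1 - cos (π * k) := by
  have hN : (0 : ℝ) < N := by
    have : 0 < N := by have := abs_nonneg k; omega
    exact_mod_cast this
  have h := sum_cos_mul N (π * k / N)
  have e1 : ((N : ℝ) - 1 / 2) * (π * k / N) = k * π - π * k / N / 2 := by field_simp
  rw [e1, sin_sub, sin_int_mul_pi] at h
  have hs : sin (π * k / N / 2) ≠ 0 := by
    intro h0
    obtain ⟨m, hm⟩ := sin_eq_zero_iff.1 h0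
    have h2 : (k : ℝ) = m * (2 * N) := by
      have := pi_ne_zero
      field_simp at hm
      linarith
    have h3 : k = m * (2 * N) := by exact_mod_cast h2
    have h4 : m ≠ 0 := by rintro rfl; simp at h3; exact hk0 h3
    have h5 : 1 ≤ |m| := Int.one_le_abs h4
    rw [h3, abs_mul, abs_of_nonneg (by positivity : (0 : ℤ) ≤ 2 * N)] at hk
    nlinarith
  apply mul_left_cancel₀ hs
  rw [mul_comm π (k : ℝ)] at h ⊢
  linarith

lemma cos_pi_mul_int_add_two_mul (a : ℝ) (b : ℤ) : cos (π * (a + 2 * b)) = cos (π * a) := by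
  have : π * (a + 2 * b) = π * a + b * (2 * π) := by ring
  rw [this, cos_add_int_mul_two_pi]

lemma sum_range_eq_sum_Ioo {N : ℕ} (F : ℕ → ℝ) (h : F 0 = 0) :
    ∑ q ∈ Finset.range N, F q = ∑ q ∈ Finset.Ioo 0 N, F q := by
  symm
  apply Finset.sum_subset
  · intro q hq
    simp only [Finset.mem_Ioo, Finset.mem_range] at *
    omega
  · intro q hq hq'
    simp only [Finset.mem_Ioo, Finset.mem_range] at *
    have : q = 0 := by omega
    rw [this, h]

/-- Discrete orthogonality of sines. -/
lemma sum_sin_mul_sin {N a b : ℕ} (ha0 : 0 < a) (ha : a < N) (hb0 : 0 < b) (hb : b < N) :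
    ∑ q ∈ Finset.Ioo 0 N, 2 / (N : ℝ) * (sin (π * q * (a / N)) * sin (π * q * (b / N)))
      = if a = b then 1 else 0 := by
  have hN : (0 : ℝ) < N := by
    have : 0 < N := by omega
    exact_mod_cast this
  rw [← sum_range_eq_sum_Ioo _ (by simp)]
  have key : ∀ q : ℕ, 2 / (N : ℝ) * (sin (π * q * (a / N)) * sin (π * q * (b / N)))
      = 1 / N * (cos (q * (π * ((a - b : ℤ) : ℝ) / N)) - cos (q * (π * ((a + b : ℤ) : ℝ) / N))) := by
    intro q
    have e1 : (q : ℝ) * (π * ((a - b : ℤ) : ℝ) / N) = π * q * (a / N) - π * q * (b / N) := by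
      push_cast; ring
    have e2 : (q : ℝ) * (π * ((a + b : ℤ) : ℝ) / N) = π * q * (a / N) + π * q * (b / N) := by
      push_cast; ring
    rw [e1, e2, cos_sub, cos_add]
    ring
  simp only [key]
  rw [← Finset.mul_sum, Finset.sum_sub_distrib]
  have h2 := sum_cos_grid (N := N) (k := a + b) (by omega) (by rw [abs_of_nonneg (by positivity)]; omega)
  split_ifs with hab
  · subst hab
    have h3 : cos (π * ((a + a : ℤ) : ℝ)) = 1 := by
      have := cos_pi_mul_int_add_two_mul 0 a
      rw [← Int.cast_ofNat, zero_add, mul_zero, cos_zero] at this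
      rw [← this]
      push_cast
      ring_nf
    rw [h3] at h2
    have h4 : ∑ q ∈ Finset.range N, cos (q * (π * ((a + a : ℤ) : ℝ) / N)) = 0 := by linarith
    rw [h4]
    simp [hN.ne']
  · have h1 := sum_cos_grid (N := N) (k := a - b) (by omega) (by rw [abs_lt]; omega)
    have h3 : cos (π * ((a + b : ℤ) : ℝ)) = cos (π * ((a - b : ℤ) : ℝ)) := by
      rw [← cos_pi_mul_int_add_two_mul ((a - b : ℤ) : ℝ) b]
      push_cast
      ring_nf
    rw [h3] at h2
    have : ∑ q ∈ Finset.range N, cos (q * (π * ((a - b : ℤ) : ℝ) / N))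
        - ∑ q ∈ Finset.range N, cos (q * (π * ((a + b : ℤ) : ℝ) / N)) = 0 := by linarith
    rw [this, mul_zero]

lemma wt_zero {N a b : ℕ} (ha0 : 0 < a) (ha : a < N) (hb0 : 0 < b) (hb : b < N) :
    wt N (fun q => sin (π * q * (a / N))) 0 (b / N) = if a = b then 1 else 0 := by
  rw [← sum_sin_mul_sin ha0 ha hb0 hb]
  simp [wt]

/-- Aliasing on the coarse grid. -/
lemma dst_eq_sub {N q : ℕ} (hq : q < N) (v : ℝ → ℝ) :
    dst N v q = dst (2 * N) v q - dst (2 * N) v (2 * N - q) := by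
  have hN : (0 : ℝ) < N := by
    have : 0 < N := by omega
    exact_mod_cast this
  rw [dst, dst, dst, ← mul_sub, ← Finset.sum_sub_distrib]
  have key : ∀ p : ℕ, v ((p : ℝ) / (2 * N : ℕ)) * sin (π * q * ((p : ℝ) / (2 * N : ℕ)))
      - v ((p : ℝ) / (2 * N : ℕ)) * sin (π * (2 * N - q : ℕ) * ((p : ℝ) / (2 * N : ℕ)))
      = (1 + (-1) ^ p) * (v ((p : ℝ) / (2 * N : ℕ)) * sin (π * q * ((p : ℝ) / (2 * N : ℕ)))) := by
    intro p
    have e : π * (2 * N - q : ℕ) * ((p : ℝ) / (2 * N : ℕ))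
        = p * π - π * q * ((p : ℝ) / (2 * N : ℕ)) := by
      rw [Nat.cast_sub (by omega)]
      push_cast
      field_simp
    rw [e, sin_sub, sin_nat_mul_pi, cos_nat_mul_pi]
    ring
  simp only [key]
  have himg : ∑ p ∈ (Finset.Ioo 0 N).image (fun r : ℕ => 2 * r),
      ((1 : ℝ) + (-1) ^ p) * (v ((p : ℝ) / (2 * N : ℕ)) * sin (π * q * ((p : ℝ) / (2 * N : ℕ))))
      = ∑ p ∈ Finset.Ioo 0 (2 * N),
      (1 + (-1) ^ p) * (v ((p : ℝ) / (2 * N : ℕ)) * sin (π * q * ((p : ℝ) / (2 * N : ℕ)))) := by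
    apply Finset.sum_subset
    · intro p hp
      simp only [Finset.mem_image, Finset.mem_Ioo] at *
      omega
    · intro p hp hp'
      have hodd : Odd p := by
        by_contra hcon
        rw [Nat.not_odd_iff_even] at hcon
        obtain ⟨r, rfl⟩ := hcon
        apply hp'
        simp only [Finset.mem_image, Finset.mem_Ioo] at *
        exact ⟨r, by omega, by omega⟩
      rw [hodd.neg_one_pow]
      simp
  rw [← himg, Finset.sum_image (fun a _ b _ h => by simpa using h), Finset.mul_sum, Finset.mul_sum]
  refine Finset.sum_congr rfl fun p _ => ?_
  have e : ((2 * p : ℕ) : ℝ) / (2 * N : ℕ) = p / N := by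
    push_cast
    field_simp
  rw [e, pow_mul]
  push_cast
  field_simp
  norm_num
  ring

lemma abs_dst_le {N : ℕ} {v : ℝ → ℝ} {C : ℝ} (hC : 0 ≤ C)
    (h : ∀ p : ℕ, 0 < p → p < N → |v ((p : ℝ) / N)| ≤ C) (q : ℕ) : |dst N v q| ≤ 2 * C := by
  rcases Nat.eq_zero_or_pos N with rfl | hN
  · simpa [dst] using hC
  have hN' : (0 : ℝ) < N := by exact_mod_cast hN
  rw [dst, abs_mul, abs_of_pos (by positivity : 0 < 2 / (N : ℝ))]
  have : |∑ p ∈ Finset.Ioo 0 N, v ((p : ℝ) / N) * sin (π * q * ((p : ℝ) / N))| ≤ N * C := by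
    refine (Finset.abs_sum_le_sum_abs _ _).trans ?_
    refine (Finset.sum_le_card_nsmul _ _ C fun p hp => ?_).trans ?_
    · rw [Finset.mem_Ioo] at hp
      rw [abs_mul]
      exact (mul_le_of_le_one_right (abs_nonneg _) (abs_sin_le_one _)).trans (h p hp.1 hp.2)
    · rw [nsmul_eq_mul, Nat.card_Ioo]
      refine mul_le_mul_of_nonneg_right ?_ hC
      exact_mod_cast (by omega : N - 0 - 1 ≤ N)
  calc 2 / (N : ℝ) * _ ≤ 2 / (N : ℝ) * (N * C) := by gcongr
    _ = 2 * C := by field_simp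

lemma sum_Ioo_eq_sum_range (n : ℕ) (F : ℕ → ℝ) :
    ∑ p ∈ Finset.Ioo 0 (n + 1), F p = ∑ p ∈ Finset.range n, F (p + 1) := by
  have : Finset.Ioo 0 (n + 1) = (Finset.range n).image (· + 1) := by
    ext p
    simp only [Finset.mem_Ioo, Finset.mem_image, Finset.mem_range]
    exact ⟨fun h => ⟨p - 1, by omega, by omega⟩, by omega⟩
  rw [this, Finset.sum_image (fun a _ b _ h => by simpa using h)]

lemma sum_range_by_parts (n : ℕ) (A S : ℕ → ℝ) :
    ∑ p ∈ Finset.range n, (A (p + 1) * (S (p + 2) - 2 * S (p + 1) + S p)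
      - (A (p + 2) - 2 * A (p + 1) + A p) * S (p + 1))
      = (A n * S (n + 1) - A (n + 1) * S n) - (A 0 * S 1 - A 1 * S 0) := by
  induction n with
  | zero => simp
  | succ n ih =>
    rw [Finset.sum_range_succ, ih]
    ring

/-- The discrete sine transform diagonalises the second difference. -/
lemma eig_mul_dst {N : ℕ} {v : ℝ → ℝ} (h0 : v 0 = 0) (h1 : v 1 = 0) (q : ℕ) :
    eig N q * dst N v q = -dst N (sndDiff (1 / N) v) q := by
  rcases N with _ | n
  · simp [dst]
  have hN : ((n + 1 : ℕ) : ℝ) ≠ 0 := by positivity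
  set S : ℕ → ℝ := fun p => sin (π * q * ((p : ℝ) / (n + 1 : ℕ))) with hS
  set A : ℕ → ℝ := fun p => v ((p : ℝ) / (n + 1 : ℕ)) with hA
  have hA0 : A 0 = 0 := by simp [hA, h0]
  have hA1 : A (n + 1) = 0 := by simp only [hA]; rw [div_self hN, h1]
  have hS0 : S 0 = 0 := by simp [hS]
  have hS1 : S (n + 1) = 0 := by
    simp only [hS]
    rw [div_self hN, mul_one, mul_comm, sin_nat_mul_pi]
  have hbp := sum_range_by_parts n A S
  rw [hA0, hA1, hS0, hS1] at hbp
  rw [Finset.sum_sub_distrib, mul_zero, zero_mul, sub_zero, mul_zero, zero_mul, sub_zero, sub_zero,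
    sub_eq_zero] at hbp
  have hsd : ∀ p : ℕ, ((n + 1 : ℕ) : ℝ) ^ 2 * (S (p + 2) - 2 * S (p + 1) + S p)
      = -(eig (n + 1) q * S (p + 1)) := by
    intro p
    have e2 : π * q * (((p + 2 : ℕ) : ℝ) / (n + 1 : ℕ))
        = π * q * (((p + 1 : ℕ) : ℝ) / (n + 1 : ℕ)) + 2 * (π * q / (2 * (n + 1 : ℕ))) := by
      push_cast; field_simp; ring
    have e0 : π * q * ((p : ℝ) / (n + 1 : ℕ))
        = π * q * (((p + 1 : ℕ) : ℝ) / (n + 1 : ℕ)) - 2 * (π * q / (2 * (n + 1 : ℕ))) := by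
      push_cast; field_simp; ring
    simp only [hS, eig]
    rw [e2, e0, sin_add, sin_sub, cos_two_mul, ← sub_eq_zero]
    have := sin_sq_add_cos_sq (π * q / (2 * ((n + 1 : ℕ) : ℝ)))
    linear_combination (4 * ((n + 1 : ℕ) : ℝ) ^ 2
      * sin (π * q * (((p + 1 : ℕ) : ℝ) / (n + 1 : ℕ)))) * this
  have hvd : ∀ p : ℕ, sndDiff (1 / (n + 1 : ℕ)) v (((p + 1 : ℕ) : ℝ) / (n + 1 : ℕ))
      = ((n + 1 : ℕ) : ℝ) ^ 2 * (A (p + 2) - 2 * A (p + 1) + A p) := by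
    intro p
    have e2 : ((p + 1 : ℕ) : ℝ) / (n + 1 : ℕ) + 1 / (n + 1 : ℕ)
        = ((p + 2 : ℕ) : ℝ) / (n + 1 : ℕ) := by push_cast; field_simp; ring
    have e0 : ((p + 1 : ℕ) : ℝ) / (n + 1 : ℕ) - 1 / (n + 1 : ℕ)
        = (p : ℝ) / (n + 1 : ℕ) := by push_cast; field_simp; ring
    rw [sndDiff, e2, e0]
    simp only [hA]
    field_simp
  rw [dst, dst, sum_Ioo_eq_sum_range, sum_Ioo_eq_sum_range]
  simp only [hvd]
  have l1 : eig (n + 1) q * (2 / ((n + 1 : ℕ) : ℝ) * ∑ p ∈ Finset.range n, A (p + 1) * S (p + 1))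
      = -(2 / ((n + 1 : ℕ) : ℝ) * (((n + 1 : ℕ) : ℝ) ^ 2 *
        ∑ p ∈ Finset.range n, A (p + 1) * (S (p + 2) - 2 * S (p + 1) + S p))) := by
    rw [mul_left_comm, ← mul_neg]
    congr 1
    rw [Finset.mul_sum, Finset.mul_sum, ← Finset.sum_neg_distrib]
    refine Finset.sum_congr rfl fun p _ => ?_
    linear_combination A (p + 1) * hsd p
  rw [l1, hbp, Finset.mul_sum]
  congr 2
  refine Finset.sum_congr rfl fun p _ => ?_
  simp only [hS]
  ring

end PoissonSparseGrid

namespace PoissonSparseGrid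

open Set Real

lemma pi_sq_le_ten : π ^ 2 ≤ 10 := by
  have := pi_lt_d2
  have := pi_pos
  nlinarith

lemma eig_nonneg (N q : ℕ) : 0 ≤ eig N q := by
  rw [eig]; positivity

lemma le_eig {N q : ℕ} (h : q ≤ N) : 4 * (q : ℝ) ^ 2 ≤ eig N q := by
  rcases Nat.eq_zero_or_pos N with rfl | hN
  · obtain rfl : q = 0 := by omega
    simp [eig]
  have hN' : (0 : ℝ) < N := by exact_mod_cast hN
  have hq : (q : ℝ) ≤ N := by exact_mod_cast h
  have hpi := pi_pos
  have h1 := mul_le_sin (x := π * q / (2 * N)) (by positivity) (by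
    rw [div_le_div_iff₀ (by positivity) (by positivity)]
    nlinarith)
  have h2 : 2 / π * (π * q / (2 * N)) = q / N := by field_simp
  rw [h2] at h1
  have h3 : ((q : ℝ) / N) ^ 2 ≤ sin (π * q / (2 * N)) ^ 2 := by gcongr
  calc 4 * (q : ℝ) ^ 2 = 4 * (N : ℝ) ^ 2 * ((q : ℝ) / N) ^ 2 := by field_simp
    _ ≤ _ := by rw [eig]; gcongr

lemma eig_le (N q : ℕ) : eig N q ≤ 10 * (q : ℝ) ^ 2 := by
  rcases Nat.eq_zero_or_pos N with rfl | hN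
  · simp [eig]
  have hN' : (0 : ℝ) < N := by exact_mod_cast hN
  calc eig N q ≤ 4 * (N : ℝ) ^ 2 * (π * q / (2 * N)) ^ 2 := by
        rw [eig]; gcongr 4 * (N : ℝ) ^ 2 * ?_; exact sin_sq_le_sq
    _ = π ^ 2 * (q : ℝ) ^ 2 := by field_simp; ring
    _ ≤ _ := by gcongr; exact pi_sq_le_ten

lemma eig_two_mul_sub (N q : ℕ) :
    eig (2 * N) q - eig N q = eig (2 * N) q ^ 2 / (16 * (N : ℝ) ^ 2) := by
  rcases Nat.eq_zero_or_pos N with rfl | hN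
  · simp [eig]
  have hN' : (0 : ℝ) < N := by exact_mod_cast hN
  have e : π * q / (2 * N) = 2 * (π * q / (2 * (2 * N : ℕ))) := by
    push_cast; field_simp
  simp only [eig]
  rw [e, sin_two_mul]
  set y := π * q / (2 * (2 * N : ℕ))
  have := sin_sq_add_cos_sq y
  have hc : cos y ^ 2 = 1 - sin y ^ 2 := by linarith
  rw [mul_pow, mul_pow, hc]
  push_cast
  field_simp
  ring

lemma abs_sin_add_sub_le {s : ℝ} (hs : 0 ≤ s) (y : ℝ) :
    |sin (y + s) - sin y - s * cos y| ≤ s ^ 2 / 2 := by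
  have := abs_le_of_deriv_le_pow (η := fun s => sin (y + s) - sin y - s * cos y)
    (η' := fun s => cos (y + s) - cos y) (H := s) (C := 1) (k := 1)
    (fun r _ => by
      have h1 : HasDerivAt (fun r => sin (y + r)) (cos (y + r)) r := by
        simpa using ((hasDerivAt_id r).const_add y).sin
      have h2 : HasDerivAt (fun r => r * cos y) (cos y) r := by
        simpa using (hasDerivAt_id r).mul_const (cos y)
      exact ((h1.sub_const (sin y)).sub h2).hasDerivWithinAt)
    (by simp)
    (fun r hr => by
      have := abs_cos_sub_cos_le (y + r) y
      rw [add_sub_cancel_left, abs_of_nonneg hr.1] at this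
      simpa using this) s ⟨hs, le_rfl⟩
  norm_num at this
  linarith

lemma abs_sin_sub_sub_le {s : ℝ} (hs : 0 ≤ s) (y : ℝ) :
    |sin (y - s) - sin y + s * cos y| ≤ s ^ 2 / 2 := by
  have := abs_sin_add_sub_le hs (π - y)
  rw [show π - y + s = π - (y - s) by ring, sin_pi_sub, sin_pi_sub, cos_pi_sub] at this
  convert this using 2
  ring

/-- Index of a mesh cell containing `x`. -/
noncomputable def cell (N : ℕ) (x : ℝ) : ℕ := min ⌊N * x⌋₊ (N - 1)

/-- Relative position of `x` in its mesh cell. -/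
noncomputable def cellPos (N : ℕ) (x : ℝ) : ℝ := N * x - cell N x

lemma cell_lt {N : ℕ} (hN : 0 < N) (x : ℝ) : cell N x < N := by
  have : cell N x ≤ N - 1 := min_le_right _ _
  omega

lemma cellPos_mem {N : ℕ} (hN : 0 < N) {x : ℝ} (hx : x ∈ Icc (0 : ℝ) 1) :
    cellPos N x ∈ Icc (0 : ℝ) 1 := by
  have h0 : (0 : ℝ) ≤ N * x := mul_nonneg (Nat.cast_nonneg _) hx.1
  have h1 : (N : ℝ) * x ≤ N := mul_le_of_le_one_right (Nat.cast_nonneg _) hx.2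
  rw [cellPos]
  rcases le_total ⌊N * x⌋₊ (N - 1) with h | h
  · rw [cell, min_eq_left h]
    have := Nat.floor_le h0
    have := Nat.lt_floor_add_one ((N : ℝ) * x)
    constructor <;> linarith
  · have h2 := Nat.floor_le h0
    have h3 : ((N - 1 : ℕ) : ℝ) ≤ ⌊(N : ℝ) * x⌋₊ := by exact_mod_cast h
    rw [cell, min_eq_right h]
    rw [Nat.cast_sub (by omega), Nat.cast_one] at *
    constructor <;> linarith

/-- Sine coefficients of the piecewise linear interpolation functional at `x`. -/
noncomputable def coef (N : ℕ) (x : ℝ) (q : ℕ) : ℝ :=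
  (1 - cellPos N x) * sin (π * q * (cell N x / N))
    + cellPos N x * sin (π * q * ((cell N x + 1 : ℕ) / N))

lemma abs_coef_le {N : ℕ} (hN : 0 < N) {x : ℝ} (hx : x ∈ Icc (0 : ℝ) 1) (q : ℕ) :
    |coef N x q| ≤ 1 := by
  obtain ⟨h0, h1⟩ := cellPos_mem hN hx
  rw [coef, abs_le]
  have a1 := neg_one_le_sin (π * q * (cell N x / N))
  have a2 := sin_le_one (π * q * (cell N x / N))
  have b1 := neg_one_le_sin (π * q * ((cell N x + 1 : ℕ) / N))
  have b2 := sin_le_one (π * q * ((cell N x + 1 : ℕ) / N))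
  constructor <;> nlinarith

lemma abs_coef_sub_le {N : ℕ} (hN : 0 < N) {x : ℝ} (hx : x ∈ Icc (0 : ℝ) 1) (q : ℕ) :
    |coef N x q - sin (π * q * x)| ≤ 10 / 8 * ((q : ℝ) / N) ^ 2 := by
  have hN' : (0 : ℝ) < N := by exact_mod_cast hN
  have hpi := pi_pos
  obtain ⟨h0, h1⟩ := cellPos_mem hN hx
  set θ := cellPos N x with hθ
  have hc : (cell N x : ℝ) = N * x - θ := by rw [hθ, cellPos]; ring
  have e1 : π * q * (cell N x / N) = π * q * x - θ * (π * q / N) := by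
    rw [hc]; field_simp
  have e2 : π * q * ((cell N x + 1 : ℕ) / N) = π * q * x + (1 - θ) * (π * q / N) := by
    push_cast; rw [hc]; field_simp; ring
  rw [coef, e1, e2]
  set y := π * q * x
  set m := π * q / N
  have hm : 0 ≤ m := by positivity
  have b1 := abs_sin_sub_sub_le (mul_nonneg h0 hm) y
  have b2 := abs_sin_add_sub_le (mul_nonneg (sub_nonneg.2 h1) hm) y
  have hm2 : m ^ 2 ≤ 10 * ((q : ℝ) / N) ^ 2 := by
    have : m ^ 2 = π ^ 2 * ((q : ℝ) / N) ^ 2 := by simp only [m]; ring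
    rw [this]
    gcongr
    exact pi_sq_le_ten
  have hθ4 : θ * (1 - θ) ≤ 1 / 4 := by nlinarith [sq_nonneg (θ - 1 / 2)]
  calc |(1 - θ) * sin (y - θ * m) + θ * sin (y + (1 - θ) * m) - sin y|
      = |(1 - θ) * (sin (y - θ * m) - sin y + θ * m * cos y)
        + θ * (sin (y + (1 - θ) * m) - sin y - (1 - θ) * m * cos y)| := by congr 1; ring
    _ ≤ (1 - θ) * ((θ * m) ^ 2 / 2) + θ * (((1 - θ) * m) ^ 2 / 2) := by
        refine (abs_add_le _ _).trans ?_
        rw [abs_mul, abs_mul, abs_of_nonneg h0, abs_of_nonneg (sub_nonneg.2 h1)]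
        have := sub_nonneg.2 h1
        gcongr
    _ = θ * (1 - θ) * m ^ 2 / 2 := by ring
    _ ≤ 1 / 4 * m ^ 2 / 2 := by gcongr
    _ ≤ _ := by linarith

lemma abs_exp_neg_sub_le {a b : ℝ} (h : a ≤ b) : |exp (-b) - exp (-a)| ≤ (b - a) * exp (-a) := by
  have h1 : exp (-b) = exp (-a) * exp (-(b - a)) := by rw [← exp_add]; congr 1; ring
  have h2 := add_one_le_exp (-(b - a))
  have h3 : exp (-b) ≤ exp (-a) := exp_le_exp.2 (by linarith)
  rw [abs_sub_comm, abs_of_nonneg (by linarith), h1]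
  nlinarith [exp_pos (-a)]

lemma exp_neg_mul_eig_le {N q : ℕ} (h : q ≤ N) {t : ℝ} (ht : 0 ≤ t) :
    exp (-(t * eig N q)) ≤ exp (-(2 * t * (q : ℝ) ^ 2)) * exp (-(2 * t * (q : ℝ) ^ 2)) := by
  rw [← exp_add, exp_le_exp]
  have := mul_le_mul_of_nonneg_left (le_eig h) ht
  linarith

lemma exp_neg_le_one {y : ℝ} (hy : 0 ≤ y) : exp (-y) ≤ 1 := by
  rw [exp_le_one_iff]; linarith

/-- Difference of the heat symbols on two consecutive meshes. -/
lemma abs_symbol_sub_le {N q : ℕ} (hq : q ≤ N) (hN : 0 < N) {t : ℝ} (ht : 0 ≤ t) {x : ℝ}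
    (hx : x ∈ Icc (0 : ℝ) 1) :
    |exp (-(t * eig (2 * N) q)) * coef (2 * N) x q - exp (-(t * eig N q)) * coef N x q|
      ≤ 7 * ((q : ℝ) / N) ^ 2 * exp (-(2 * t * (q : ℝ) ^ 2)) := by
  have hN' : (0 : ℝ) < N := by exact_mod_cast hN
  set E := exp (-(2 * t * (q : ℝ) ^ 2)) with hE
  have hE0 : 0 < E := exp_pos _
  have hE1 : E ≤ 1 := exp_neg_le_one (by positivity)
  have hE2 : t * (q : ℝ) ^ 2 * E ≤ 1 / 2 := by
    have := add_one_le_exp (2 * t * (q : ℝ) ^ 2)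
    have h2 : exp (2 * t * (q : ℝ) ^ 2) * E = 1 := by rw [hE, ← exp_add]; simp
    nlinarith
  have a1 := exp_neg_mul_eig_le hq ht
  have a2 := exp_neg_mul_eig_le (show q ≤ 2 * N by omega) ht
  rw [← hE] at a1 a2
  have hEE : E * E ≤ E := mul_le_of_le_one_left hE0.le hE1
  have c1 := abs_coef_sub_le (N := 2 * N) (by omega) hx q
  have c2 := abs_coef_sub_le hN hx q
  have hmid : |exp (-(t * eig (2 * N) q)) - exp (-(t * eig N q))|
      ≤ 100 / 32 * ((q : ℝ) / N) ^ 2 * E := by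
    have hd := eig_two_mul_sub N q
    have hle : eig (2 * N) q - eig N q ≤ 100 / 16 * (q : ℝ) ^ 4 / (N : ℝ) ^ 2 := by
      rw [hd]
      have h3 : eig (2 * N) q ^ 2 ≤ (10 * (q : ℝ) ^ 2) ^ 2 :=
        pow_le_pow_left₀ (eig_nonneg _ _) (eig_le _ _) 2
      calc eig (2 * N) q ^ 2 / (16 * (N : ℝ) ^ 2) ≤ (10 * (q : ℝ) ^ 2) ^ 2 / (16 * (N : ℝ) ^ 2) := by
            gcongr
        _ = _ := by field_simp; ring
    have h0 : 0 ≤ eig (2 * N) q - eig N q := by rw [hd]; positivity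
    refine (abs_exp_neg_sub_le (mul_le_mul_of_nonneg_left (sub_nonneg.1 h0) ht)).trans ?_
    rw [← mul_sub]
    calc t * (eig (2 * N) q - eig N q) * exp (-(t * eig N q))
        ≤ t * (100 / 16 * (q : ℝ) ^ 4 / (N : ℝ) ^ 2) * (E * E) := by gcongr
      _ = 100 / 16 * ((q : ℝ) / N) ^ 2 * (t * (q : ℝ) ^ 2 * E) * E := by field_simp
      _ ≤ 100 / 16 * ((q : ℝ) / N) ^ 2 * (1 / 2) * E := by gcongr
      _ = _ := by ring
  have hN2 : ((q : ℝ) / (2 * N : ℕ)) ^ 2 = ((q : ℝ) / N) ^ 2 / 4 := by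
    push_cast; field_simp; norm_num
  rw [hN2] at c1
  set S := sin (π * q * x)
  have hS : |S| ≤ 1 := abs_sin_le_one _
  set Q := ((q : ℝ) / N) ^ 2
  have hQ : 0 ≤ Q := by positivity
  calc |exp (-(t * eig (2 * N) q)) * coef (2 * N) x q - exp (-(t * eig N q)) * coef N x q|
      = |exp (-(t * eig (2 * N) q)) * (coef (2 * N) x q - S)
        + (exp (-(t * eig (2 * N) q)) - exp (-(t * eig N q))) * S
        - exp (-(t * eig N q)) * (coef N x q - S)| := by congr 1; ring
    _ ≤ E * (10 / 8 * (Q / 4)) + (100 / 32 * Q * E) * 1 + E * (10 / 8 * Q) := by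
        refine (abs_sub _ _).trans (add_le_add ((abs_add_le _ _).trans (add_le_add ?_ ?_)) ?_)
        · rw [abs_mul, abs_of_pos (exp_pos _)]
          gcongr
          exact a2.trans hEE
        · rw [abs_mul]
          gcongr
        · rw [abs_mul, abs_of_pos (exp_pos _)]
          gcongr
          exact a1.trans hEE
    _ ≤ 7 * Q * E := by nlinarith [mul_nonneg hQ hE0.le]

end PoissonSparseGrid

namespace PoissonSparseGrid

open Set Real

namespace DerivChain

variable {M : ℝ} {G : ℕ → ℝ → ℝ}

lemma sndDiff_nodes {N p : ℕ} (h0 : 0 < p) (h1 : p < N) :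
    0 < 1 / (N : ℝ) ∧ 0 ≤ (p : ℝ) / N - 1 / N ∧ (p : ℝ) / N + 1 / N ≤ 1 := by
  have hN : (0 : ℝ) < N := by
    have : 0 < N := by omega
    exact_mod_cast this
  have h2 : (1 : ℝ) ≤ p := by exact_mod_cast h0
  have h3 : (p : ℝ) + 1 ≤ N := by exact_mod_cast h1
  refine ⟨by positivity, ?_, ?_⟩
  · rw [← sub_div]; exact div_nonneg (by linarith) hN.le
  · rw [← add_div, div_le_one hN]; exact h3

lemma abs_dst_two_mul_eig_le (hG : DerivChain M G) {N q : ℕ} :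
    |dst N (G 2) q| * eig N q ≤ 2 * M := by
  have h := eig_mul_dst (N := N) (hG.zero 2 (by norm_num)) (hG.one 2 (by norm_num)) q
  have h2 := abs_dst_le (N := N) (v := sndDiff (1 / N) (G 2)) hG.nonneg (fun p hp0 hp1 => by
    obtain ⟨a, b, c⟩ := sndDiff_nodes hp0 hp1
    exact hG.abs_sndDiff_two_le a b c) q
  rw [← abs_neg, ← h, abs_mul, abs_of_nonneg (eig_nonneg _ _)] at h2
  linarith

lemma abs_dst_two_le (hG : DerivChain M G) {N q : ℕ} (hq0 : 0 < q) (hq : q ≤ N) :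
    |dst N (G 2) q| ≤ M / 2 * 1 / (q : ℝ) ^ 2 := by
  have h := hG.abs_dst_two_mul_eig_le (N := N) (q := q)
  have h1 := mul_le_mul_of_nonneg_left (le_eig hq) (abs_nonneg (dst N (G 2) q))
  have hq' : (0 : ℝ) < q := by exact_mod_cast hq0
  rw [le_div_iff₀ (by positivity)]
  linarith

lemma abs_dst_zero_le (hG : DerivChain M G) {N q : ℕ} (hq0 : 0 < q) (hq : q ≤ N) :
    |dst N (G 0) q| ≤ M / 6 * (1 / (q : ℝ) ^ 2) / (q : ℝ) ^ 2 := by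
  have hq' : (0 : ℝ) < q := by exact_mod_cast hq0
  have hN' : (0 : ℝ) < N := hq'.trans_le (by exact_mod_cast hq)
  have h := eig_mul_dst (N := N) (hG.zero 0 (by norm_num)) (hG.one 0 (by norm_num)) q
  have hsplit : dst N (sndDiff (1 / N) (G 0)) q
      = dst N (G 2) q + dst N (fun p => sndDiff (1 / N) (G 0) p - G 2 p) q := by
    simp only [dst]
    rw [← mul_add, ← Finset.sum_add_distrib]
    congr 1
    exact Finset.sum_congr rfl fun p _ => by ring
  have hC : 0 ≤ M * (1 / (N : ℝ)) ^ 2 / 12 := by have := hG.nonneg; positivity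
  have h2 := abs_dst_le (N := N) (v := fun p => sndDiff (1 / N) (G 0) p - G 2 p) hC
    (fun p hp0 hp1 => by
      obtain ⟨a, b, c⟩ := sndDiff_nodes hp0 hp1
      exact hG.abs_sndDiff_sub_le a b c) q
  have h3 := hG.abs_dst_two_le hq0 hq
  have h4 : |dst N (sndDiff (1 / N) (G 0)) q| ≤ M / 2 * 1 / (q : ℝ) ^ 2
      + 2 * (M * (1 / (N : ℝ)) ^ 2 / 12) := by
    rw [hsplit]
    exact (abs_add_le _ _).trans (add_le_add h3 h2)
  have h5 : (1 / (N : ℝ)) ^ 2 ≤ 1 / (q : ℝ) ^ 2 := by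
    rw [one_div_pow]
    gcongr
  have h6 : |dst N (sndDiff (1 / N) (G 0)) q| ≤ 2 / 3 * M / (q : ℝ) ^ 2 := by
    refine h4.trans ?_
    have := mul_le_mul_of_nonneg_left h5 hG.nonneg
    have e : 2 / 3 * M / (q : ℝ) ^ 2 = 2 / 3 * (M * (1 / (q : ℝ) ^ 2)) := by ring
    have e2 : M / 2 * 1 / (q : ℝ) ^ 2 = 1 / 2 * (M * (1 / (q : ℝ) ^ 2)) := by ring
    rw [e, e2]
    linarith
  rw [← abs_neg, ← h, abs_mul, abs_of_nonneg (eig_nonneg _ _)] at h6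
  have h7 := mul_le_mul_of_nonneg_right (le_eig hq) (abs_nonneg (dst N (G 0) q))
  have h8 : 4 * (q : ℝ) ^ 2 * |dst N (G 0) q| ≤ 2 / 3 * M / (q : ℝ) ^ 2 := h7.trans h6
  have e : M / 6 * (1 / (q : ℝ) ^ 2) = (2 / 3 * M / (q : ℝ) ^ 2) / 4 := by ring
  rw [le_div_iff₀ (by positivity), e]
  linarith

end DerivChain

/-- Difference of the semidiscrete solutions on two consecutive meshes. -/
lemma abs_sum_wt_sub_le {N : ℕ} (hN : 0 < N) {t : ℝ} (ht : 0 ≤ t) {x : ℝ}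
    (hx : x ∈ Icc (0 : ℝ) 1) {v : ℝ → ℝ} {M : ℝ} (hM : 0 ≤ M) {ρ : ℕ → ℝ} (hρ : ∀ q, 0 ≤ ρ q)
    (hanti : ∀ p q, 0 < p → p ≤ q → ρ q ≤ ρ p)
    (hv : ∀ q, 0 < q → q < 2 * N → |dst (2 * N) v q| ≤ M * ρ q / (q : ℝ) ^ 2) :
    |∑ s ∈ pts (2 * N), wt (2 * N) (coef (2 * N) x) t s * v s
        - ∑ s ∈ pts N, wt N (coef N x) t s * v s|
      ≤ 8 * M / (N : ℝ) ^ 2 * ∑ q ∈ Finset.Ioo 0 (2 * N), ρ q * exp (-(2 * t * (q : ℝ) ^ 2)) := by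
  have hN' : (0 : ℝ) < N := by exact_mod_cast hN
  rw [sum_wt_mul, sum_wt_mul]
  have hfil : ∑ q ∈ Finset.Ioo 0 N, exp (-(t * eig N q)) * coef N x q * dst N v q
      = ∑ q ∈ Finset.Ioo 0 (2 * N), if q < N then
          exp (-(t * eig N q)) * coef N x q * dst N v q else 0 := by
    rw [← Finset.sum_filter]
    congr 1
    ext q
    simp only [Finset.mem_Ioo, Finset.mem_filter]
    omega
  rw [hfil, ← Finset.sum_sub_distrib, Finset.mul_sum]
  refine (Finset.abs_sum_le_sum_abs _ _).trans (Finset.sum_le_sum fun q hq => ?_)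
  rw [Finset.mem_Ioo] at hq
  have hq' : (0 : ℝ) < q := by exact_mod_cast hq.1
  set E := exp (-(2 * t * (q : ℝ) ^ 2)) with hE
  have hE0 : 0 < E := exp_pos _
  have hE1 : E ≤ 1 := exp_neg_le_one (by positivity)
  have hEE : E * E ≤ E := mul_le_of_le_one_left hE0.le hE1
  have hρq := hρ q
  split_ifs with hqN
  · have hr : (N : ℝ) ≤ (2 * N - q : ℕ) := by exact_mod_cast (by omega : N ≤ 2 * N - q)
    have d1 := hv q hq.1 hq.2
    have d2 := hv (2 * N - q) (by omega) (by omega)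
    have d3 : |dst (2 * N) v (2 * N - q)| ≤ M * ρ q / (N : ℝ) ^ 2 := by
      refine d2.trans ?_
      have := hanti q (2 * N - q) hq.1 (by omega)
      gcongr
    have s1 := abs_symbol_sub_le hqN.le hN ht hx
    have a1 := (exp_neg_mul_eig_le hqN.le ht).trans hEE
    have c1 := abs_coef_le hN hx q
    rw [dst_eq_sub hqN]
    calc _ = |(exp (-(t * eig (2 * N) q)) * coef (2 * N) x q - exp (-(t * eig N q)) * coef N x q)
          * dst (2 * N) v q + exp (-(t * eig N q)) * coef N x q * dst (2 * N) v (2 * N - q)| := by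
          congr 1; ring
      _ ≤ 7 * ((q : ℝ) / N) ^ 2 * E * (M * ρ q / (q : ℝ) ^ 2) + E * 1 * (M * ρ q / (N : ℝ) ^ 2) := by
          refine (abs_add_le _ _).trans (add_le_add ?_ ?_)
          · rw [abs_mul]
            gcongr
          · rw [abs_mul, abs_mul, abs_of_pos (exp_pos _)]
            gcongr
      _ = _ := by field_simp; ring
  · have a2 := (exp_neg_mul_eig_le hq.2.le ht).trans hEE
    have c2 := abs_coef_le (N := 2 * N) (by omega) hx q
    have d1 := hv q hq.1 hq.2
    have hNq : (N : ℝ) ≤ q := by exact_mod_cast not_lt.1 hqN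
    have d2 : |dst (2 * N) v q| ≤ M * ρ q / (N : ℝ) ^ 2 := d1.trans (by gcongr)
    rw [sub_zero, abs_mul, abs_mul, abs_of_pos (exp_pos _)]
    calc _ ≤ E * 1 * (M * ρ q / (N : ℝ) ^ 2) := by gcongr
      _ ≤ 8 * (E * 1 * (M * ρ q / (N : ℝ) ^ 2)) := by
          have : 0 ≤ E * 1 * (M * ρ q / (N : ℝ) ^ 2) := by positivity
          linarith
      _ = _ := by ring

lemma sum_one_div_sq_le (n : ℕ) : ∑ q ∈ Finset.Ioo 0 n, 1 / (q : ℝ) ^ 2 ≤ 2 := by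
  have h := sum_Ioo_inv_sq_le (α := ℝ) 0 n
  simpa using h

/-- Weights of the level-`i` functional, extended by zero. -/
noncomputable def lw (x t s : ℝ) (i : ℕ) : ℝ :=
  open Classical in if s ∈ pts (2 ^ i) then wt (2 ^ i) (coef (2 ^ i) x) t s else 0

lemma sum_lw_mul {i L : ℕ} (h : i ≤ L) (x t : ℝ) (v : ℝ → ℝ) :
    ∑ s ∈ pts (2 ^ L), lw x t s i * v s
      = ∑ s ∈ pts (2 ^ i), wt (2 ^ i) (coef (2 ^ i) x) t s * v s := by
  rw [← Finset.sum_subset (pts_two_pow_subset h)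
    (fun s _ hs => by rw [lw, if_neg hs, zero_mul])]
  exact Finset.sum_congr rfl fun s hs => by rw [lw, if_pos hs]

lemma abs_sum_bdiff_lw_le {i L : ℕ} (h : i ≤ L) {t : ℝ} (ht : 0 ≤ t) {x : ℝ}
    (hx : x ∈ Icc (0 : ℝ) 1) {v : ℝ → ℝ} {M : ℝ} (hM : 0 ≤ M) {ρ : ℕ → ℝ} (hρ : ∀ q, 0 ≤ ρ q)
    (hanti : ∀ p q, 0 < p → p ≤ q → ρ q ≤ ρ p)
    (hv : ∀ N q, 0 < q → q ≤ N → |dst N v q| ≤ M * ρ q / (q : ℝ) ^ 2) :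
    |∑ s ∈ pts (2 ^ L), bdiff (lw x t s) i * v s|
      ≤ 32 * M * (4 ^ i : ℝ)⁻¹ *
        ∑ q ∈ Finset.Ioo 0 (2 ^ i), ρ q * exp (-(2 * t * (q : ℝ) ^ 2)) := by
  cases i with
  | zero =>
    simp only [bdiff]
    rw [sum_lw_mul h]
    simp [pts, show Finset.Ioo 0 1 = (∅ : Finset ℕ) from rfl]
  | succ i =>
    simp only [bdiff, sub_mul]
    rw [Finset.sum_sub_distrib, sum_lw_mul h, sum_lw_mul (by omega : i ≤ L)]
    have := abs_sum_wt_sub_le (N := 2 ^ i) (by positivity) ht hx hM hρ hanti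
      (fun q h0 h1 => hv (2 * 2 ^ i) q h0 h1.le)
    rw [pow_succ' 2 i]
    refine this.trans (le_of_eq ?_)
    congr 1
    have : ((2 ^ i : ℕ) : ℝ) ^ 2 = 4 ^ i := by
      push_cast; rw [← pow_mul, mul_comm, pow_mul]; norm_num
    rw [this, pow_succ]
    field_simp
    ring

/-- Hierarchical surplus functional applied to a function. -/
lemma DerivChain.abs_sum_bdiff_zero_le {M : ℝ} {G : ℕ → ℝ → ℝ} (hG : DerivChain M G) {i L : ℕ}
    (h : i ≤ L) {t : ℝ} (ht : 0 ≤ t) {x : ℝ} (hx : x ∈ Icc (0 : ℝ) 1) :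
    |∑ s ∈ pts (2 ^ L), bdiff (lw x t s) i * G 0 s| ≤ 16 * (4 ^ i : ℝ)⁻¹ * M := by
  have hM := hG.nonneg
  have := abs_sum_bdiff_lw_le h ht hx (v := G 0) (M := M / 6) (by positivity)
    (ρ := fun q => 1 / (q : ℝ) ^ 2) (fun q => by positivity)
    (fun p q hp hpq => by
      have : (0 : ℝ) < p := by exact_mod_cast hp
      show 1 / (q : ℝ) ^ 2 ≤ 1 / (p : ℝ) ^ 2
      gcongr)
    (fun N q h0 h1 => hG.abs_dst_zero_le h0 h1)
  have h2 : ∑ q ∈ Finset.Ioo (0 : ℕ) (2 ^ i), 1 / (q : ℝ) ^ 2 * exp (-(2 * t * (q : ℝ) ^ 2)) ≤ 2 :=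
    (Finset.sum_le_sum fun q _ => mul_le_of_le_one_right (by positivity)
      (exp_neg_le_one (by positivity))).trans (sum_one_div_sq_le _)
  refine this.trans ?_
  calc _ ≤ 32 * (M / 6) * (4 ^ i : ℝ)⁻¹ * 2 := by gcongr
    _ ≤ 16 * (4 ^ i : ℝ)⁻¹ * M := by
      have : 0 ≤ (4 ^ i : ℝ)⁻¹ * M := by positivity
      linarith

/-- Bound for the hierarchical surplus functional applied to a second derivative. -/
noncomputable def sndBound (i : ℕ) (t : ℝ) : ℝ :=
  16 * (4 ^ i : ℝ)⁻¹ * ∑ q ∈ Finset.Ioo (0 : ℕ) (2 ^ i), exp (-(2 * t * (q : ℝ) ^ 2))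

lemma DerivChain.abs_sum_bdiff_two_le {M : ℝ} {G : ℕ → ℝ → ℝ} (hG : DerivChain M G) {i L : ℕ}
    (h : i ≤ L) {t : ℝ} (ht : 0 ≤ t) {x : ℝ} (hx : x ∈ Icc (0 : ℝ) 1) :
    |∑ s ∈ pts (2 ^ L), bdiff (lw x t s) i * G 2 s| ≤ sndBound i t * M := by
  have hM := hG.nonneg
  have := abs_sum_bdiff_lw_le h ht hx (v := G 2) (M := M / 2) (by positivity)
    (ρ := fun _ => 1) (fun q => zero_le_one) (fun p q hp hpq => le_rfl)
    (fun N q h0 h1 => hG.abs_dst_two_le h0 h1)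
  refine this.trans (le_of_eq ?_)
  simp only [one_mul, sndBound]
  ring

lemma integrableOn_exp_neg_mul {b : ℝ} (hb : 0 < b) :
    MeasureTheory.IntegrableOn (fun t => exp (-(b * t))) (Ioi 0) := by
  simpa using integrableOn_exp_mul_Ioi (a := -b) (by linarith) 0

lemma integral_exp_neg_mul {b : ℝ} (hb : 0 < b) :
    ∫ t in Ioi (0 : ℝ), exp (-(b * t)) = 1 / b := by
  have := integral_exp_mul_Ioi (a := -b) (by linarith) 0
  simpa using this

lemma integrableOn_sndBound (i : ℕ) : MeasureTheory.IntegrableOn (sndBound i) (Ioi 0) := by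
  unfold sndBound
  refine MeasureTheory.Integrable.const_mul (MeasureTheory.integrable_finsetSum _ fun q hq => ?_) _
  have hq' : (0 : ℝ) < q := by exact_mod_cast (Finset.mem_Ioo.1 hq).1
  have := integrableOn_exp_neg_mul (b := 2 * (q : ℝ) ^ 2) (by positivity)
  refine this.congr_fun (fun t _ => ?_) measurableSet_Ioi
  ring_nf

lemma integral_sndBound_le (i : ℕ) : ∫ t in Ioi (0 : ℝ), sndBound i t ≤ 20 * (4 ^ i : ℝ)⁻¹ := by
  unfold sndBound
  have key : ∀ q ∈ Finset.Ioo (0 : ℕ) (2 ^ i), 0 < 2 * (q : ℝ) ^ 2 := fun q hq => by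
    have hq' : (0 : ℝ) < q := by exact_mod_cast (Finset.mem_Ioo.1 hq).1
    positivity
  have e : ∀ (q : ℕ) (t : ℝ), exp (-(2 * t * (q : ℝ) ^ 2)) = exp (-(2 * (q : ℝ) ^ 2 * t)) := by
    intro q t; ring_nf
  simp only [e]
  rw [MeasureTheory.integral_const_mul, MeasureTheory.integral_finsetSum _
    (fun q hq => integrableOn_exp_neg_mul (key q hq)),
    Finset.sum_congr rfl (fun q hq => integral_exp_neg_mul (key q hq))]
  have h2 : ∑ q ∈ Finset.Ioo (0 : ℕ) (2 ^ i), 1 / (2 * (q : ℝ) ^ 2) ≤ 1 := by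
    have := sum_one_div_sq_le (2 ^ i)
    have e2 : ∀ q : ℕ, 1 / (2 * (q : ℝ) ^ 2) = 1 / 2 * (1 / (q : ℝ) ^ 2) := by
      intro q; rw [one_div_mul_one_div]
    simp only [e2]
    rw [← Finset.mul_sum]
    linarith
  calc _ ≤ 16 * (4 ^ i : ℝ)⁻¹ * 1 := by gcongr
    _ ≤ _ := by
      have : 0 < (4 ^ i : ℝ)⁻¹ := by positivity
      linarith

end PoissonSparseGrid

namespace PoissonSparseGrid

open Set Function

variable {d : ℕ}

lemma mderiv_zero (u : (Fin d → ℝ) → ℝ) : mderiv d 0 u = u := by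
  rw [mderiv]
  induction List.finRange d with
  | nil => rfl
  | cons a L ih => simp

lemma foldr_pd_update (u : (Fin d → ℝ) → ℝ) (β : Fin d → ℕ) (i : Fin d)
    (hβ : ∀ l < i, β l = 0) (L : List (Fin d)) (hL : L.Pairwise (· < ·)) (hi : i ∈ L) :
    L.foldr (fun l v => (pd d l)^[update β i (β i + 1) l] v) u
      = pd d i (L.foldr (fun l v => (pd d l)^[β l] v) u) := by
  induction L with
  | nil => simp at hi
  | cons a L ih =>
    rw [List.pairwise_cons] at hL
    rw [List.foldr_cons, List.foldr_cons]
    by_cases ha : a = i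
    · subst ha
      rw [update_self, iterate_succ_apply']
      congr 2
      refine List.foldr_ext _ _ _ fun l hl v => ?_
      rw [update_of_ne (hL.1 l hl).ne']
    · have hiL : i ∈ L := by
        rcases List.mem_cons.1 hi with h | h
        · exact absurd h.symm ha
        · exact h
      rw [update_of_ne ha, hβ a (hL.1 i hiL), iterate_zero, id, id, ih hL.2 hiL]

lemma mderiv_update (u : (Fin d → ℝ) → ℝ) (β : Fin d → ℕ) (i : Fin d) (hβ : ∀ l < i, β l = 0) :
    mderiv d (update β i (β i + 1)) u = pd d i (mderiv d β u) :=
  foldr_pd_update u β i hβ _ (List.pairwise_lt_finRange d) (List.mem_finRange i)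

lemma mderiv_single_two (u : (Fin d → ℝ) → ℝ) (j : Fin d) :
    mderiv d (update 0 j 2) u = pd d j (pd d j u) := by
  have h1 := mderiv_update u 0 j (fun _ _ => rfl)
  have h2 := mderiv_update u (update 0 j 1) j (fun l hl => by rw [update_of_ne hl.ne]; rfl)
  rw [mderiv_zero, Pi.zero_apply, zero_add] at h1
  rw [update_self, update_idem, h1] at h2
  exact h2

lemma update_mem_unitCube {x : Fin d → ℝ} (hx : x ∈ unitCube d) (j : Fin d) {τ : ℝ}
    (hτ : τ ∈ Icc (0 : ℝ) 1) : update x j τ ∈ unitCube d := by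
  refine ⟨fun l => ?_, fun l => ?_⟩ <;> by_cases h : l = j
  · subst h; simpa using hτ.1
  · simpa [h] using hx.1 l
  · subst h; simpa using hτ.2
  · simpa [h] using hx.2 l

/-- Apply the functionals `g ↦ ∑ s ∈ A l, w l s * g s` to the first `m` coordinates. -/
noncomputable def partialTensor (A : Fin d → Finset ℝ) (w : Fin d → ℝ → ℝ) :
    ℕ → ((Fin d → ℝ) → ℝ) → (Fin d → ℝ) → ℝ
  | 0, F => F
  | m + 1, F => fun x => if h : m < d then
      ∑ s ∈ A ⟨m, h⟩, w ⟨m, h⟩ s * partialTensor A w m F (update x ⟨m, h⟩ s)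
    else partialTensor A w m F x

lemma piFinset_update_sum {d : ℕ} (B : Fin d → Finset ℝ) (m : Fin d) (C : Finset ℝ)
    (H : (Fin d → ℝ) → ℝ) :
    ∑ a ∈ Fintype.piFinset (update B m C), H a
      = ∑ s ∈ C, ∑ a ∈ Fintype.piFinset (update B m {s}), H a := by
  rw [← Finset.sum_fiberwise_of_maps_to (g := fun a => a m) (t := C)]
  · refine Finset.sum_congr rfl fun s hs => ?_
    congr 1
    ext a
    simp only [Finset.mem_filter, Fintype.mem_piFinset]
    constructor
    · rintro ⟨h1, h2⟩ l
      by_cases hl : l = m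
      · subst hl; simpa using h2
      · simpa [hl] using h1 l
    · intro h
      have hm : a m = s := by simpa using h m
      refine ⟨fun l => ?_, hm⟩
      by_cases hl : l = m
      · subst hl; simpa [hm] using hs
      · simpa [hl] using h l
  · intro a ha
    simpa using Fintype.mem_piFinset.1 ha m

lemma partialTensor_eq (A : Fin d → Finset ℝ) (w : Fin d → ℝ → ℝ) (F : (Fin d → ℝ) → ℝ) (m : ℕ) :
    ∀ x, partialTensor A w m F x
      = ∑ a ∈ Fintype.piFinset fun l : Fin d => if (l : ℕ) < m then A l else {x l},
        (∏ l : Fin d, if (l : ℕ) < m then w l (a l) else 1) * F a := by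
  induction m with
  | zero =>
    intro x
    simp [partialTensor, Fintype.piFinset_singleton]
  | succ m ih =>
    intro x
    rw [partialTensor]
    split_ifs with h
    · have hB : (fun l : Fin d => if (l : ℕ) < m + 1 then A l else {x l})
          = update (fun l : Fin d => if (l : ℕ) < m then A l else {x l}) ⟨m, h⟩ (A ⟨m, h⟩) := by
        funext l
        by_cases hl : l = ⟨m, h⟩
        · subst hl; simp
        · have : (l : ℕ) ≠ m := fun h' => hl (Fin.ext h')
          rw [update_of_ne hl]
          congr 1
          simp only [eq_iff_iff]
          omega
      rw [hB, piFinset_update_sum]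
      refine Finset.sum_congr rfl fun s _ => ?_
      rw [ih, Finset.mul_sum]
      have hB2 : (fun l : Fin d => if (l : ℕ) < m then A l else {update x ⟨m, h⟩ s l})
          = update (fun l : Fin d => if (l : ℕ) < m then A l else {x l}) ⟨m, h⟩ {s} := by
        funext l
        by_cases hl : l = ⟨m, h⟩
        · subst hl; simp
        · rw [update_of_ne hl, update_of_ne hl]
      rw [hB2]
      refine Finset.sum_congr rfl fun a ha => ?_
      have ham : a ⟨m, h⟩ = s := by simpa using Fintype.mem_piFinset.1 ha ⟨m, h⟩
      rw [← mul_assoc]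
      congr 1
      rw [← Finset.mul_prod_erase _ _ (Finset.mem_univ (⟨m, h⟩ : Fin d)),
        ← Finset.mul_prod_erase _ (fun l : Fin d => if (l : ℕ) < m + 1 then w l (a l) else 1)
          (Finset.mem_univ (⟨m, h⟩ : Fin d))]
      simp only [lt_self_iff_false, if_false, one_mul, lt_add_iff_pos_right, zero_lt_one, if_true,
        ham]
      congr 1
      refine Finset.prod_congr rfl fun l hl => ?_
      have : (l : ℕ) ≠ m := fun h' => (Finset.mem_erase.1 hl).1 (Fin.ext h')
      congr 1
      simp only [eq_iff_iff]
      omega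
    · change partialTensor A w m F x = _
      rw [ih]
      have : ∀ l : Fin d, ((l : ℕ) < m) = ((l : ℕ) < m + 1) := by
        intro l
        have := l.2
        simp only [eq_iff_iff]
        omega
      simp only [this]

lemma partialTensor_full (A : Fin d → Finset ℝ) (w : Fin d → ℝ → ℝ) (F : (Fin d → ℝ) → ℝ)
    (x : Fin d → ℝ) :
    partialTensor A w d F x = ∑ a ∈ Fintype.piFinset A, (∏ l, w l (a l)) * F a := by
  rw [partialTensor_eq]
  simp

section

variable {A : Fin d → Finset ℝ} {w : Fin d → ℝ → ℝ}

lemma partialTensor_hasDeriv (hA : ∀ l, ∀ s ∈ A l, s ∈ Icc (0 : ℝ) 1)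
    {F F' : (Fin d → ℝ) → ℝ} (j : Fin d)
    (hF : ∀ y ∈ unitCube d, HasDerivWithinAt (fun τ => F (update y j τ)) (F' y) (Icc 0 1) (y j))
    (m : ℕ) (hm : m ≤ j) :
    ∀ y ∈ unitCube d, HasDerivWithinAt (fun τ => partialTensor A w m F (update y j τ))
      (partialTensor A w m F' y) (Icc 0 1) (y j) := by
  induction m with
  | zero => exact hF
  | succ m ih =>
    intro y hy
    have h : m < d := by omega
    have hne : j ≠ ⟨m, h⟩ := fun h' => by rw [h'] at hm; simp at hm
    simp only [partialTensor, h, dif_pos]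
    refine HasDerivWithinAt.fun_sum fun s hs => ?_
    have := (ih (by omega) _ (update_mem_unitCube hy ⟨m, h⟩ (hA _ s hs))).const_mul (w ⟨m, h⟩ s)
    rw [update_of_ne hne] at this
    simpa only [update_comm hne] using this

lemma partialTensor_eq_zero (hA : ∀ l, ∀ s ∈ A l, s ∈ Icc (0 : ℝ) 1)
    {F : (Fin d → ℝ) → ℝ} (j : Fin d)
    (hF : ∀ y ∈ unitCube d, y j = 0 ∨ y j = 1 → F y = 0) (m : ℕ) (hm : m ≤ j) :
    ∀ y ∈ unitCube d, y j = 0 ∨ y j = 1 → partialTensor A w m F y = 0 := by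
  induction m with
  | zero => exact hF
  | succ m ih =>
    intro y hy hyj
    have h : m < d := by omega
    have hne : j ≠ ⟨m, h⟩ := fun h' => by rw [h'] at hm; simp at hm
    simp only [partialTensor, h, dif_pos]
    refine Finset.sum_eq_zero fun s hs => ?_
    rw [ih (by omega) _ (update_mem_unitCube hy ⟨m, h⟩ (hA _ s hs)) (by rwa [update_of_ne hne]),
      mul_zero]

lemma derivChain_partialTensor {u : (Fin d → ℝ) → ℝ} (hu : MemX d 4 u)
    (hA : ∀ l, ∀ s ∈ A l, s ∈ Icc (0 : ℝ) 1) {α : Fin d → ℕ} (hα : ∀ l, α l ≤ 4) (j : Fin d)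
    (hαj : ∀ l ≤ j, α l = 0) {m : ℕ} (hm : m ≤ j) {M : ℝ}
    (hM : ∀ y ∈ unitCube d, |partialTensor A w m (mderiv d (update α j 4) u) y| ≤ M)
    {x : Fin d → ℝ} (hx : x ∈ unitCube d) :
    DerivChain M (fun k τ => partialTensor A w m (mderiv d (update α j k) u) (update x j τ)) := by
  have hle : ∀ k ≤ 4, ∀ l, update α j k l ≤ 4 := by
    intro k hk l
    by_cases hl : l = j
    · subst hl; simpa using hk
    · simpa [hl] using hα l
  have hend : ∀ k ≤ 4, ∀ y ∈ unitCube d, y j = 0 ∨ y j = 1 →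
      partialTensor A w m (mderiv d (update α j k) u) y = 0 := fun k hk =>
    partialTensor_eq_zero hA j (fun y hy hyj => (hu.2 _ (hle k hk)).2 y ⟨hy, j, hyj⟩) m hm
  refine ⟨fun k hk τ hτ => ?_, fun k hk => ?_, fun k hk => ?_, fun τ hτ => ?_⟩
  · have hF : ∀ y ∈ unitCube d, HasDerivWithinAt
        (fun τ => mderiv d (update α j k) u (update y j τ))
        (mderiv d (update α j (k + 1)) u y) (Icc 0 1) (y j) := by
      intro y hy
      have h1 := (hu.1 (update α j k) (hle k hk.le) j (by simpa using hk) y hy).hasDerivWithinAt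
      have h2 := mderiv_update u (update α j k) j (fun l hl => by
        rw [update_of_ne hl.ne, hαj l hl.le])
      rw [update_self, update_idem] at h2
      rw [h2]
      exact h1
    have := partialTensor_hasDeriv (w := w) hA j hF m hm (update x j τ) (update_mem_unitCube hx j hτ)
    rw [update_self] at this
    simpa only [update_idem] using this
  · exact hend k hk _ (update_mem_unitCube hx j ⟨le_rfl, zero_le_one⟩) (Or.inl (by simp))
  · exact hend k hk _ (update_mem_unitCube hx j ⟨zero_le_one, le_rfl⟩) (Or.inr (by simp))
  · exact hM _ (update_mem_unitCube hx j hτ)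

lemma abs_partialTensor_le {u : (Fin d → ℝ) → ℝ} (hu : MemX d 4 u) {K : ℝ}
    (hK : ∀ α : Fin d → ℕ, (∀ i, α i ≤ 4) → ∀ x ∈ unitCube d, |mderiv d α u x| ≤ K)
    (hA : ∀ l, ∀ s ∈ A l, s ∈ Icc (0 : ℝ) 1) {C : Fin d → ℝ}
    (hC : ∀ l M G, DerivChain M G → |∑ s ∈ A l, w l s * G 0 s| ≤ C l * M) (m : ℕ) (hm : m ≤ d) :
    ∀ α : Fin d → ℕ, (∀ l, α l ≤ 4) → (∀ l : Fin d, (l : ℕ) < m → α l = 0) → ∀ x ∈ unitCube d,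
      |partialTensor A w m (mderiv d α u) x|
        ≤ (∏ l ∈ Finset.univ.filter (fun l : Fin d => (l : ℕ) < m), C l) * K := by
  induction m with
  | zero =>
    intro α hα _ x hx
    simpa [partialTensor] using hK α hα x hx
  | succ m ih =>
    intro α hα hα0 x hx
    have h : m < d := by omega
    set j : Fin d := ⟨m, h⟩ with hj
    have hle : ∀ l, update α j 4 l ≤ 4 := by
      intro l
      by_cases hl : l = j
      · subst hl; simp
      · simpa [hl] using hα l
    have hch := derivChain_partialTensor (A := A) (w := w) hu hA hα j
      (fun l hl => hα0 l (Nat.lt_succ_of_le hl)) (m := m) le_rfl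
      (fun y hy => ih h.le (update α j 4) hle (fun l hl => by
        rw [update_of_ne (fun h' => by rw [h'] at hl; simp [hj] at hl)]
        exact hα0 l (by omega)) y hy) hx
    have := hC j _ _ hch
    have hα' : update α j 0 = α := by
      rw [← hα0 j (Nat.lt_succ_self m), update_eq_self]
    rw [hα', ← mul_assoc] at this
    have hfil : Finset.univ.filter (fun l : Fin d => (l : ℕ) < m + 1)
        = insert j (Finset.univ.filter (fun l : Fin d => (l : ℕ) < m)) := by
      ext l
      simp only [Finset.mem_filter, Finset.mem_univ, true_and, Finset.mem_insert, Fin.ext_iff, hj]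
      omega
    rw [hfil, Finset.prod_insert (by simp [hj])]
    simpa only [partialTensor, h, dif_pos] using this

/-- Tensor products of functionals bounded on derivative chains are bounded on `X_4^d`. -/
lemma abs_tensor_le {u : (Fin d → ℝ) → ℝ} (hu : MemX d 4 u) {K : ℝ}
    (hK : ∀ α : Fin d → ℕ, (∀ i, α i ≤ 4) → ∀ x ∈ unitCube d, |mderiv d α u x| ≤ K)
    (hA : ∀ l, ∀ s ∈ A l, s ∈ Icc (0 : ℝ) 1) {C : Fin d → ℝ}
    (hC : ∀ l M G, DerivChain M G → |∑ s ∈ A l, w l s * G 0 s| ≤ C l * M) :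
    |∑ a ∈ Fintype.piFinset A, (∏ l, w l (a l)) * u a| ≤ (∏ l, C l) * K := by
  have := abs_partialTensor_le (w := w) hu hK hA hC d le_rfl 0 (fun _ => by simp) (fun _ _ => rfl) 0
    ⟨le_rfl, fun _ => zero_le_one⟩
  rw [mderiv_zero, partialTensor_full] at this
  simpa using this

end

lemma derivChain_slice {u : (Fin d → ℝ) → ℝ} (hu : MemX d 4 u) {K : ℝ}
    (hK : ∀ α : Fin d → ℕ, (∀ i, α i ≤ 4) → ∀ x ∈ unitCube d, |mderiv d α u x| ≤ K)
    (j : Fin d) {x : Fin d → ℝ} (hx : x ∈ unitCube d) :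
    DerivChain K (fun k τ => mderiv d (update 0 j k) u (update x j τ)) := by
  have := derivChain_partialTensor (A := fun _ => ∅) (w := 0) hu (by simp) (α := 0)
    (fun l => by simp) j (fun _ _ => rfl) (m := 0) (Nat.zero_le _) (M := K)
    (fun y hy => hK _ (fun l => by
      by_cases hl : l = j
      · subst hl; simp
      · simp [hl]) y hy) hx
  exact this

end PoissonSparseGrid

namespace PoissonSparseGrid

open Set Function Filter Topology

variable {d : ℕ}

lemma sum_piFinset_update_singleton (A : Fin d → Finset ℝ) (j : Fin d) (s : ℝ)
    (H : (Fin d → ℝ) → ℝ) :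
    ∑ a ∈ Fintype.piFinset (update A j {s}), H a
      = ∑ b ∈ Fintype.piFinset (update A j {0}), H (update b j s) := by
  have aux : ∀ (r r' : ℝ), ∀ a ∈ Fintype.piFinset (update A j {r}),
      update a j r' ∈ Fintype.piFinset (update A j {r'}) := by
    intro r r' a ha
    rw [Fintype.mem_piFinset] at *
    intro l
    by_cases hl : l = j
    · subst hl; simp
    · simpa [hl] using ha l
  have aux2 : ∀ r : ℝ, ∀ a ∈ Fintype.piFinset (update A j {r}), update a j r = a := by
    intro r a ha
    have : a j = r := by simpa using Fintype.mem_piFinset.1 ha j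
    rw [← this, update_eq_self]
  refine Finset.sum_nbij' (fun a => update a j 0) (fun b => update b j s)
    (aux s 0) (aux 0 s) (fun a ha => ?_) (fun a ha => ?_) (fun a ha => ?_)
  · simp only [update_idem, aux2 s a ha]
  · simp only [update_idem, aux2 0 a ha]
  · simp only [update_idem, aux2 s a ha]

lemma tensor_peel (A : Fin d → Finset ℝ) (w : Fin d → ℝ → ℝ) (j : Fin d) (B : Finset ℝ)
    (v : ℝ → ℝ) (H : (Fin d → ℝ) → ℝ) :
    ∑ a ∈ Fintype.piFinset (update A j B), (∏ l, update w j v l (a l)) * H a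
      = ∑ b ∈ Fintype.piFinset (update A j {0}), (∏ l ∈ Finset.univ.erase j, w l (b l))
        * ∑ r ∈ B, v r * H (update b j r) := by
  rw [piFinset_update_sum]
  rw [Finset.sum_congr rfl fun s _ => sum_piFinset_update_singleton A j s _, Finset.sum_comm]
  simp_rw [Finset.mul_sum]
  refine Finset.sum_congr rfl fun b _ => Finset.sum_congr rfl fun r _ => ?_
  rw [← Finset.mul_prod_erase _ _ (Finset.mem_univ j), update_self, update_self]
  have : ∏ l ∈ Finset.univ.erase j, update w j v l (update b j r l)
      = ∏ l ∈ Finset.univ.erase j, w l (b l) :=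
    Finset.prod_congr rfl fun l hl => by
      rw [update_of_ne (Finset.ne_of_mem_erase hl), update_of_ne (Finset.ne_of_mem_erase hl)]
  rw [this]
  ring

/-- Weights of the functional `g ↦ ∑ s ∈ S, v s * sndDiff ε g s`. -/
noncomputable def diffWeight (S : Finset ℝ) (v : ℝ → ℝ) (ε r : ℝ) : ℝ :=
  ∑ s ∈ S, v s / ε ^ 2 * ((if s + ε = r then 1 else 0) - 2 * (if s = r then 1 else 0)
    + (if s - ε = r then 1 else 0))

/-- Nodes of the functional `g ↦ ∑ s ∈ S, v s * sndDiff ε g s`. -/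
noncomputable def diffNodes (S : Finset ℝ) (ε : ℝ) : Finset ℝ :=
  S ∪ S.image (· + ε) ∪ S.image (· - ε)

lemma sum_diffWeight_mul (S : Finset ℝ) (v : ℝ → ℝ) (ε : ℝ) (g : ℝ → ℝ) :
    ∑ r ∈ diffNodes S ε, diffWeight S v ε r * g r = ∑ s ∈ S, v s * sndDiff ε g s := by
  simp only [diffWeight, Finset.sum_mul]
  rw [Finset.sum_comm]
  refine Finset.sum_congr rfl fun s hs => ?_
  have h1 : s + ε ∈ diffNodes S ε := by
    simp only [diffNodes, Finset.mem_union, Finset.mem_image]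
    exact Or.inl (Or.inr ⟨s, hs, rfl⟩)
  have h2 : s ∈ diffNodes S ε := by
    simp only [diffNodes, Finset.mem_union, Finset.mem_image]
    exact Or.inl (Or.inl hs)
  have h3 : s - ε ∈ diffNodes S ε := by
    simp only [diffNodes, Finset.mem_union, Finset.mem_image]
    exact Or.inr ⟨s, hs, rfl⟩
  have e : ∀ r, v s / ε ^ 2 * ((if s + ε = r then 1 else 0) - 2 * (if s = r then 1 else 0)
      + (if s - ε = r then 1 else 0)) * g r
      = v s / ε ^ 2 * ((if s + ε = r then g r else 0) - 2 * (if s = r then g r else 0)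
      + (if s - ε = r then g r else 0)) := by
    intro r
    split_ifs <;> ring
  simp only [e]
  rw [← Finset.mul_sum, Finset.sum_add_distrib, Finset.sum_sub_distrib, ← Finset.mul_sum,
    Finset.sum_ite_eq, Finset.sum_ite_eq, Finset.sum_ite_eq, if_pos h1, if_pos h2, if_pos h3,
    sndDiff]
  ring

section

variable {A : Fin d → Finset ℝ} {w : Fin d → ℝ → ℝ} {u : (Fin d → ℝ) → ℝ} {K : ℝ}

lemma abs_tensor_snd_le_add (hu : MemX d 4 u)
    (hK : ∀ α : Fin d → ℕ, (∀ i, α i ≤ 4) → ∀ x ∈ unitCube d, |mderiv d α u x| ≤ K)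
    (hA : ∀ l, ∀ s ∈ A l, s ∈ Icc (0 : ℝ) 1) {C : Fin d → ℝ}
    (hC : ∀ l M G, DerivChain M G → |∑ s ∈ A l, w l s * G 0 s| ≤ C l * M)
    (j : Fin d) {D : ℝ} (hD : ∀ M G, DerivChain M G → |∑ s ∈ A j, w j s * G 2 s| ≤ D * M)
    {ε : ℝ} (hε : 0 < ε) (hεA : ∀ s ∈ A j, 0 ≤ s - ε ∧ s + ε ≤ 1) :
    |∑ a ∈ Fintype.piFinset A, (∏ l, w l (a l)) * pd d j (pd d j u) a|
      ≤ (∏ l ∈ Finset.univ.erase j, C l) * (D + (∑ s ∈ A j, |w j s|) * (ε ^ 2 / 12)) * K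
        + (∑ a ∈ Fintype.piFinset A, |∏ l, w l (a l)|) * (K * ε ^ 2 / 12) := by
  have hD' : ∀ M G, DerivChain M G → |∑ s ∈ A j, w j s * sndDiff ε (G 0) s|
      ≤ (D + (∑ s ∈ A j, |w j s|) * (ε ^ 2 / 12)) * M := by
    intro M G hG
    have e : ∑ s ∈ A j, w j s * sndDiff ε (G 0) s
        = ∑ s ∈ A j, w j s * G 2 s + ∑ s ∈ A j, w j s * (sndDiff ε (G 0) s - G 2 s) := by
      rw [← Finset.sum_add_distrib]
      exact Finset.sum_congr rfl fun s _ => by ring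
    rw [e, add_mul]
    refine (abs_add_le _ _).trans (add_le_add (hD M G hG) ?_)
    rw [Finset.sum_mul, Finset.sum_mul]
    refine (Finset.abs_sum_le_sum_abs _ _).trans (Finset.sum_le_sum fun s hs => ?_)
    rw [abs_mul, mul_assoc]
    have := hG.abs_sndDiff_sub_le hε (hεA s hs).1 (hεA s hs).2
    gcongr
    linarith
  have hmain := abs_tensor_le (A := update A j (diffNodes (A j) ε))
    (w := update w j (diffWeight (A j) (w j) ε)) hu hK
    (C := update C j (D + (∑ s ∈ A j, |w j s|) * (ε ^ 2 / 12)))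
    (fun l s hs => by
      by_cases hl : l = j
      · subst hl
        rw [update_self, diffNodes] at hs
        simp only [Finset.mem_union, Finset.mem_image] at hs
        rcases hs with (hs | ⟨r, hr, rfl⟩) | ⟨r, hr, rfl⟩
        · exact hA _ s hs
        · exact ⟨by linarith [(hA _ r hr).1], (hεA r hr).2⟩
        · exact ⟨(hεA r hr).1, by linarith [(hA _ r hr).2]⟩
      · rw [update_of_ne hl] at hs
        exact hA l s hs)
    (fun l M G hG => by
      by_cases hl : l = j
      · subst hl
        simp only [update_self]
        rw [sum_diffWeight_mul]
        exact hD' M G hG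
      · simp only [update_of_ne hl]
        exact hC l M G hG)
  rw [tensor_peel] at hmain
  simp only [sum_diffWeight_mul] at hmain
  rw [← Finset.mul_prod_erase _ _ (Finset.mem_univ j), update_self,
    Finset.prod_congr rfl (fun l hl => by rw [update_of_ne (Finset.ne_of_mem_erase hl)] :
      ∀ l ∈ Finset.univ.erase j, update C j _ l = C l)] at hmain
  have hpeel := tensor_peel A w j (A j) (w j) (fun a => sndDiff ε (fun τ => u (update a j τ)) (a j))
  rw [update_eq_self, update_eq_self] at hpeel
  simp only [update_self, update_idem] at hpeel
  rw [← hpeel] at hmain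
  have hdiff : |∑ a ∈ Fintype.piFinset A, (∏ l, w l (a l)) * pd d j (pd d j u) a
      - ∑ a ∈ Fintype.piFinset A, (∏ l, w l (a l)) * sndDiff ε (fun τ => u (update a j τ)) (a j)|
      ≤ (∑ a ∈ Fintype.piFinset A, |∏ l, w l (a l)|) * (K * ε ^ 2 / 12) := by
    rw [← Finset.sum_sub_distrib, Finset.sum_mul]
    refine (Finset.abs_sum_le_sum_abs _ _).trans (Finset.sum_le_sum fun a ha => ?_)
    rw [← mul_sub, abs_mul]
    have hmem := fun l => Fintype.mem_piFinset.1 ha l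
    have hch := derivChain_slice hu hK j (x := a)
      ⟨fun l => (hA l _ (hmem l)).1, fun l => (hA l _ (hmem l)).2⟩
    have := hch.abs_sndDiff_sub_le hε (hεA _ (hmem j)).1 (hεA _ (hmem j)).2
    have e0 : update (0 : Fin d → ℕ) j 0 = 0 := update_eq_self j 0
    rw [abs_sub_comm] at this
    simp only [e0, mderiv_zero, update_eq_self, mderiv_single_two] at this
    gcongr
  have := abs_sub_abs_le_abs_sub
    (∑ a ∈ Fintype.piFinset A, (∏ l, w l (a l)) * pd d j (pd d j u) a)
    (∑ a ∈ Fintype.piFinset A, (∏ l, w l (a l)) * sndDiff ε (fun τ => u (update a j τ)) (a j))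
  linarith

/-- Tensor functional applied to a pure second derivative. -/
lemma abs_tensor_snd_le (hu : MemX d 4 u)
    (hK : ∀ α : Fin d → ℕ, (∀ i, α i ≤ 4) → ∀ x ∈ unitCube d, |mderiv d α u x| ≤ K)
    (hA : ∀ l, ∀ s ∈ A l, s ∈ Ioo (0 : ℝ) 1) {C : Fin d → ℝ}
    (hC : ∀ l M G, DerivChain M G → |∑ s ∈ A l, w l s * G 0 s| ≤ C l * M)
    (j : Fin d) {D : ℝ} (hD : ∀ M G, DerivChain M G → |∑ s ∈ A j, w j s * G 2 s| ≤ D * M) :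
    |∑ a ∈ Fintype.piFinset A, (∏ l, w l (a l)) * pd d j (pd d j u) a|
      ≤ (∏ l ∈ Finset.univ.erase j, C l) * D * K := by
  have hlim : Tendsto (fun ε : ℝ =>
      (∏ l ∈ Finset.univ.erase j, C l) * (D + (∑ s ∈ A j, |w j s|) * (ε ^ 2 / 12)) * K
        + (∑ a ∈ Fintype.piFinset A, |∏ l, w l (a l)|) * (K * ε ^ 2 / 12)) (𝓝[>] 0)
      (𝓝 ((∏ l ∈ Finset.univ.erase j, C l) * D * K)) := by
    have hc : Continuous (fun ε : ℝ =>
      (∏ l ∈ Finset.univ.erase j, C l) * (D + (∑ s ∈ A j, |w j s|) * (ε ^ 2 / 12)) * K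
        + (∑ a ∈ Fintype.piFinset A, |∏ l, w l (a l)|) * (K * ε ^ 2 / 12)) := by fun_prop
    have := (hc.tendsto 0).mono_left (nhdsWithin_le_nhds (s := Ioi 0))
    simpa using this
  refine ge_of_tendsto hlim ?_
  have h1 : ∀ᶠ ε in 𝓝[>] (0 : ℝ), ∀ s ∈ A j, 0 ≤ s - ε ∧ s + ε ≤ 1 := by
    rw [Finset.eventually_all]
    intro s hs
    have h0 := hA j s hs
    have a1 : ∀ᶠ ε in 𝓝 (0 : ℝ), ε < s := Iio_mem_nhds h0.1
    have a2 : ∀ᶠ ε in 𝓝 (0 : ℝ), ε < 1 - s := Iio_mem_nhds (by linarith [h0.2])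
    filter_upwards [nhdsWithin_le_nhds a1, nhdsWithin_le_nhds a2] with ε h1 h2
    constructor <;> linarith
  filter_upwards [h1, self_mem_nhdsWithin] with ε hε hε0
  exact abs_tensor_snd_le_add hu hK (fun l s hs => Ioo_subset_Icc_self (hA l s hs)) hC j hD hε0 hε

end

end PoissonSparseGrid

namespace PoissonSparseGrid

open Set Function Filter Topology Real MeasureTheory

variable {d : ℕ}

/-- Sine coefficients of the grid node `r`. -/
noncomputable def nodeCoef (N r q : ℕ) : ℝ := sin (π * q * ((r : ℝ) / N))

/-- Semidiscrete heat flow of the grid function `f`, tested against sine coefficients `c`. -/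
noncomputable def heat (lvl : Fin d → ℕ) (f : (Fin d → ℝ) → ℝ) (c : Fin d → ℕ → ℝ) (t : ℝ) : ℝ :=
  ∑ s ∈ Fintype.piFinset fun l => pts (2 ^ lvl l), (∏ l, wt (2 ^ lvl l) (c l) t (s l)) * f s

lemma hasDerivAt_wt (N : ℕ) (c : ℕ → ℝ) (s t : ℝ) :
    HasDerivAt (fun t => wt N c t s) (wt N (fun q => -eig N q * c q) t s) t := by
  unfold wt
  refine HasDerivAt.fun_sum fun q _ => ?_
  have h1 : HasDerivAt (fun t => exp (-(t * eig N q))) (exp (-(t * eig N q)) * -(1 * eig N q)) t :=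
    (((hasDerivAt_id t).mul_const (eig N q)).neg).exp
  refine (((h1.mul_const (c q)).mul_const (sin (π * q * s))).const_mul (2 / (N : ℝ))).congr_deriv ?_
  ring

lemma neg_eig_mul_nodeCoef {N r : ℕ} (hr : 1 ≤ r) (q : ℕ) :
    -eig N q * nodeCoef N r q
      = (N : ℝ) ^ 2 * (nodeCoef N (r + 1) q - 2 * nodeCoef N r q + nodeCoef N (r - 1) q) := by
  obtain ⟨r, rfl⟩ := Nat.exists_eq_add_of_le' hr
  simp only [eig, nodeCoef, Nat.add_sub_cancel]
  push_cast
  have e1 : π * q * (((r : ℝ) + 1 + 1) / N) = π * q * (((r : ℝ) + 1) / N) + 2 * (π * q / (2 * N)) := by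
    field_simp
  have e2 : π * q * ((r : ℝ) / N) = π * q * (((r : ℝ) + 1) / N) - 2 * (π * q / (2 * N)) := by
    field_simp
    ring
  rw [e1, e2, sin_add, sin_sub, cos_two_mul, sin_sq]
  ring

lemma wt_neg_eig_mul_nodeCoef {N r : ℕ} (hr : 1 ≤ r) (t s : ℝ) :
    wt N (fun q => -eig N q * nodeCoef N r q) t s
      = (N : ℝ) ^ 2 * (wt N (nodeCoef N (r + 1)) t s - 2 * wt N (nodeCoef N r) t s
        + wt N (nodeCoef N (r - 1)) t s) := by
  simp only [wt, neg_eig_mul_nodeCoef hr]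
  rw [Finset.mul_sum, ← Finset.sum_sub_distrib, ← Finset.sum_add_distrib, Finset.mul_sum]
  exact Finset.sum_congr rfl fun q _ => by ring

lemma exists_abs_wt_le (N : ℕ) (c : ℕ → ℝ) (s : ℝ) :
    ∃ B, 0 ≤ B ∧ ∀ t, 0 ≤ t → |wt N c t s| ≤ B * exp (-t) := by
  refine ⟨∑ q ∈ Finset.Ioo 0 N, 2 / (N : ℝ) * |c q|, Finset.sum_nonneg fun q _ => by positivity,
    fun t ht => ?_⟩
  rw [wt, Finset.sum_mul]
  refine (Finset.abs_sum_le_sum_abs _ _).trans (Finset.sum_le_sum fun q hq => ?_)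
  rw [Finset.mem_Ioo] at hq
  have h1 : (1 : ℝ) ≤ eig N q := by
    have := le_eig hq.2.le
    have h2 : (1 : ℝ) ≤ q := by exact_mod_cast hq.1
    nlinarith
  have h2 : exp (-(t * eig N q)) ≤ exp (-t) := exp_le_exp.2 (by nlinarith)
  have h3 := abs_sin_le_one (π * q * s)
  rw [abs_mul, abs_mul, abs_mul, abs_of_pos (exp_pos _), abs_of_nonneg (by positivity)]
  calc 2 / (N : ℝ) * (exp (-(t * eig N q)) * |c q| * |sin (π * q * s)|)
      ≤ 2 / (N : ℝ) * (exp (-t) * |c q| * 1) := by gcongr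
    _ = _ := by ring

lemma exists_abs_heat_le (hd : 1 ≤ d) (lvl : Fin d → ℕ) (f : (Fin d → ℝ) → ℝ)
    (c : Fin d → ℕ → ℝ) : ∃ B, ∀ t, 0 ≤ t → |heat lvl f c t| ≤ B * exp (-t) := by
  choose B hB0 hB using fun (s : Fin d → ℝ) (l : Fin d) =>
    exists_abs_wt_le (2 ^ lvl l) (c l) (s l)
  refine ⟨∑ s ∈ Fintype.piFinset fun l => pts (2 ^ lvl l), (∏ l, B s l) * |f s|, fun t ht => ?_⟩
  rw [heat, Finset.sum_mul]
  refine (Finset.abs_sum_le_sum_abs _ _).trans (Finset.sum_le_sum fun s _ => ?_)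
  rw [abs_mul, Finset.abs_prod]
  have h1 : ∏ l, |wt (2 ^ lvl l) (c l) t (s l)| ≤ ∏ l, (B s l * exp (-t)) :=
    Finset.prod_le_prod (fun _ _ => abs_nonneg _) fun l _ => hB s l t ht
  rw [Finset.prod_mul_distrib, Finset.prod_const, Finset.card_univ, Fintype.card_fin] at h1
  have h2 : exp (-t) ^ d ≤ exp (-t) :=
    pow_le_of_le_one (exp_pos _).le (exp_le_one_iff.2 (by linarith)) (by omega)
  have h3 : 0 ≤ ∏ l, B s l := Finset.prod_nonneg fun l _ => hB0 s l
  calc (∏ l, |wt (2 ^ lvl l) (c l) t (s l)|) * |f s|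
      ≤ ((∏ l, B s l) * exp (-t)) * |f s| := by gcongr; exact h1.trans (by gcongr)
    _ = _ := by ring

lemma continuous_wt (N : ℕ) (c : ℕ → ℝ) (s : ℝ) : Continuous fun t => wt N c t s := by
  unfold wt
  fun_prop

lemma continuous_heat (lvl : Fin d → ℕ) (f : (Fin d → ℝ) → ℝ) (c : Fin d → ℕ → ℝ) :
    Continuous (heat lvl f c) := by
  unfold heat
  exact continuous_finsetSum _ fun s _ =>
    (continuous_finsetProd _ fun l _ => continuous_wt _ _ _).mul continuous_const

lemma integrableOn_heat (hd : 1 ≤ d) (lvl : Fin d → ℕ) (f : (Fin d → ℝ) → ℝ)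
    (c : Fin d → ℕ → ℝ) : IntegrableOn (heat lvl f c) (Ioi 0) := by
  obtain ⟨B, hB⟩ := exists_abs_heat_le hd lvl f c
  have h1 : IntegrableOn (fun t : ℝ => B * exp (-t)) (Ioi 0) :=
    (integrableOn_exp_neg_Ioi 0).const_mul B
  refine Integrable.mono' h1 (continuous_heat lvl f c).aestronglyMeasurable ?_
  filter_upwards [ae_restrict_mem measurableSet_Ioi] with t ht
  exact hB t ht.le

lemma tendsto_heat (hd : 1 ≤ d) (lvl : Fin d → ℕ) (f : (Fin d → ℝ) → ℝ)
    (c : Fin d → ℕ → ℝ) : Tendsto (heat lvl f c) atTop (𝓝 0) := by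
  obtain ⟨B, hB⟩ := exists_abs_heat_le hd lvl f c
  have h1 : Tendsto (fun t : ℝ => B * exp (-t)) atTop (𝓝 0) := by
    simpa using tendsto_exp_neg_atTop_nhds_zero.const_mul B
  refine squeeze_zero_norm' ?_ h1
  filter_upwards [eventually_ge_atTop 0] with t ht
  exact hB t ht

/-- Coefficients of all coordinates of the grid node `r`. -/
noncomputable def gridCoef (lvl r : Fin d → ℕ) (l : Fin d) : ℕ → ℝ := nodeCoef (2 ^ lvl l) (r l)

lemma prod_erase_mul_wt_update (lvl r : Fin d → ℕ) (t : ℝ) (s : Fin d → ℝ) (k : Fin d) (m : ℕ) :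
    ∏ l, wt (2 ^ lvl l) (gridCoef lvl (update r k m) l) t (s l)
      = (∏ l ∈ Finset.univ.erase k, wt (2 ^ lvl l) (gridCoef lvl r l) t (s l))
        * wt (2 ^ lvl k) (nodeCoef (2 ^ lvl k) m) t (s k) := by
  rw [← Finset.prod_erase_mul _ _ (Finset.mem_univ k)]
  simp only [gridCoef, update_self]
  congr 1
  refine Finset.prod_congr rfl fun l hl => ?_
  rw [update_of_ne (Finset.ne_of_mem_erase hl)]

lemma hasDerivAt_heat (lvl : Fin d → ℕ) (f : (Fin d → ℝ) → ℝ) {r : Fin d → ℕ}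
    (hr : ∀ k, 1 ≤ r k) (t : ℝ) :
    HasDerivAt (heat lvl f (gridCoef lvl r))
      (∑ k, (heat lvl f (gridCoef lvl (update r k (r k + 1))) t
        - 2 * heat lvl f (gridCoef lvl r) t
        + heat lvl f (gridCoef lvl (update r k (r k - 1))) t) / hmesh d lvl k ^ 2) t := by
  have h : HasDerivAt (heat lvl f (gridCoef lvl r))
      (∑ s ∈ Fintype.piFinset fun l => pts (2 ^ lvl l),
        (∑ k, (∏ l ∈ Finset.univ.erase k, wt (2 ^ lvl l) (gridCoef lvl r l) t (s l))
          • wt (2 ^ lvl k) (fun q => -eig (2 ^ lvl k) q * gridCoef lvl r k q) t (s k)) * f s) t := by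
    unfold heat
    exact HasDerivAt.fun_sum fun s _ =>
      (HasDerivAt.fun_finsetProd fun l _ => hasDerivAt_wt _ _ _ _).mul_const _
  refine h.congr_deriv ?_
  simp only [heat, Finset.sum_mul, Finset.mul_sum, ← Finset.sum_sub_distrib,
    ← Finset.sum_add_distrib, Finset.sum_div]
  rw [Finset.sum_comm]
  refine Finset.sum_congr rfl fun k _ => Finset.sum_congr rfl fun s _ => ?_
  rw [prod_erase_mul_wt_update, prod_erase_mul_wt_update,
    ← Finset.prod_erase_mul Finset.univ (fun l => wt (2 ^ lvl l) (gridCoef lvl r l) t (s l))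
      (Finset.mem_univ k)]
  have := wt_neg_eig_mul_nodeCoef (N := 2 ^ lvl k) (hr k) t (s k)
  simp only [gridCoef, smul_eq_mul] at *
  rw [this, hmesh, inv_pow, div_inv_eq_mul]
  push_cast
  ring

lemma heat_zero (lvl : Fin d → ℕ) (f : (Fin d → ℝ) → ℝ) {r : Fin d → ℕ}
    (hr : ∀ k, 1 ≤ r k ∧ r k < 2 ^ lvl k) :
    heat lvl f (gridCoef lvl r) 0 = f (gridpt d lvl r) := by
  have hpt : ∀ l, gridpt d lvl r l = (r l : ℝ) / (2 ^ lvl l : ℕ) := fun l => by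
    simp [gridpt, hmesh, div_eq_mul_inv]
  have hwt : ∀ l, ∀ s ∈ pts (2 ^ lvl l), wt (2 ^ lvl l) (gridCoef lvl r l) 0 s
      = if s = gridpt d lvl r l then 1 else 0 := by
    intro l s hs
    obtain ⟨p, h0, h1, rfl⟩ := mem_pts.1 hs
    have := wt_zero (hr l).1 (hr l).2 h0 h1
    have hN : ((2 ^ lvl l : ℕ) : ℝ) ≠ 0 := by positivity
    simp only [hpt, div_left_inj' hN, Nat.cast_inj, eq_comm (a := p)]
    exact this
  rw [heat, Finset.sum_eq_single (gridpt d lvl r)]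
  · rw [Finset.prod_eq_one, one_mul]
    intro l _
    rw [hwt, if_pos rfl]
    exact mem_pts.2 ⟨r l, (hr l).1, (hr l).2, (hpt l).symm⟩
  · intro s hs hne
    obtain ⟨l, hl⟩ := Function.ne_iff.1 hne
    rw [Finset.prod_eq_zero (Finset.mem_univ l), zero_mul]
    rw [hwt l _ (Fintype.mem_piFinset.1 hs l), if_neg hl]
  · intro h
    refine absurd (Fintype.mem_piFinset.2 fun l => ?_) h
    exact mem_pts.2 ⟨r l, (hr l).1, (hr l).2, (hpt l).symm⟩

lemma heat_bdry (lvl : Fin d → ℕ) (f : (Fin d → ℝ) → ℝ) {r : Fin d → ℕ}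
    (hr : ∃ k, r k = 0 ∨ r k = 2 ^ lvl k) (t : ℝ) : heat lvl f (gridCoef lvl r) t = 0 := by
  obtain ⟨k, hk⟩ := hr
  have h0 : ∀ q, gridCoef lvl r k q = 0 := by
    intro q
    rcases hk with hk | hk
    · simp [gridCoef, nodeCoef, hk]
    · have hN : ((2 ^ lvl k : ℕ) : ℝ) ≠ 0 := by positivity
      rw [gridCoef, nodeCoef, hk, div_self hN, mul_one, mul_comm, sin_nat_mul_pi]
  refine Finset.sum_eq_zero fun s _ => ?_
  rw [Finset.prod_eq_zero (Finset.mem_univ k), zero_mul]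
  simp [wt, h0]

/-- The time integral of the semidiscrete heat flow solves the finite difference equations. -/
lemma isFDPoisson_integral_heat (hd : 1 ≤ d) (lvl : Fin d → ℕ) (f : (Fin d → ℝ) → ℝ) :
    IsFDPoisson d lvl f fun r => -∫ t in Ioi (0 : ℝ), heat lvl f (gridCoef lvl r) t := by
  refine ⟨fun r _ hr => ?_, fun r hr => ?_⟩
  · simp [heat_bdry lvl f hr]
  · have hint := fun c => integrableOn_heat hd lvl f c
    have hD : ∀ k, IntegrableOn (fun t => (heat lvl f (gridCoef lvl (update r k (r k + 1))) t
        - 2 * heat lvl f (gridCoef lvl r) t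
        + heat lvl f (gridCoef lvl (update r k (r k - 1))) t) / hmesh d lvl k ^ 2) (Ioi 0) :=
      fun k => (((hint _).sub ((hint _).const_mul 2)).add (hint _)).div_const _
    have h := integral_Ioi_of_hasDerivAt_of_tendsto
      (continuous_heat lvl f (gridCoef lvl r)).continuousWithinAt
      (fun t _ => hasDerivAt_heat lvl f (fun k => (hr k).1) t)
      (integrable_finsetSum _ fun k _ => hD k) (tendsto_heat hd lvl f _)
    rw [heat_zero lvl f hr, integral_finsetSum _ fun k _ => hD k] at h
    have e : ∀ k, ∫ t in Ioi (0 : ℝ), (heat lvl f (gridCoef lvl (update r k (r k + 1))) t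
        - 2 * heat lvl f (gridCoef lvl r) t
        + heat lvl f (gridCoef lvl (update r k (r k - 1))) t) / hmesh d lvl k ^ 2
        = ((∫ t in Ioi (0 : ℝ), heat lvl f (gridCoef lvl (update r k (r k + 1))) t)
        - 2 * (∫ t in Ioi (0 : ℝ), heat lvl f (gridCoef lvl r) t)
        + ∫ t in Ioi (0 : ℝ), heat lvl f (gridCoef lvl (update r k (r k - 1))) t)
          / hmesh d lvl k ^ 2 := by
      intro k
      have h1 : IntegrableOn (fun t => heat lvl f (gridCoef lvl (update r k (r k + 1))) t
          - 2 * heat lvl f (gridCoef lvl r) t) (Ioi 0) := (hint _).sub ((hint _).const_mul 2)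
      rw [integral_div, integral_add h1 (hint _), integral_sub (hint _) ((hint _).const_mul 2),
        integral_const_mul]
    simp only [e] at h
    rw [← neg_inj, ← zero_sub (f _), ← h, ← Finset.sum_neg_distrib]
    exact Finset.sum_congr rfl fun k _ => by ring

end PoissonSparseGrid

namespace PoissonSparseGrid

open Set Function Filter Topology Real MeasureTheory

variable {d : ℕ}

lemma hmesh_pos (lvl : Fin d → ℕ) (k : Fin d) : 0 < hmesh d lvl k := by
  unfold hmesh
  positivity

lemma gridpt_update (lvl r : Fin d → ℕ) (k : Fin d) (m : ℕ) :
    gridpt d lvl (update r k m) = update (gridpt d lvl r) k (m * hmesh d lvl k) := by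
  funext l
  by_cases hl : l = k
  · subst hl; simp [gridpt]
  · simp [gridpt, hl]

lemma mul_hmesh_le_one (lvl : Fin d → ℕ) {k : Fin d} {m : ℕ} (hm : m ≤ 2 ^ lvl k) :
    m * hmesh d lvl k ≤ 1 := by
  have : (m : ℝ) ≤ 2 ^ lvl k := by exact_mod_cast hm
  rw [hmesh, ← div_eq_mul_inv]
  exact div_le_one_of_le₀ this (by positivity)

lemma gridpt_mem_unitCube (lvl : Fin d → ℕ) {r : Fin d → ℕ} (hr : IsGridIdx d lvl r) :
    gridpt d lvl r ∈ unitCube d :=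
  ⟨fun k => mul_nonneg (Nat.cast_nonneg _) (hmesh_pos lvl k).le, fun k => mul_hmesh_le_one lvl (hr k)⟩

lemma gridpt_mem_openCube (lvl : Fin d → ℕ) {r : Fin d → ℕ}
    (hr : ∀ k, 1 ≤ r k ∧ r k < 2 ^ lvl k) : gridpt d lvl r ∈ openCube d := by
  intro k _
  have h1 : (0 : ℝ) < r k := by exact_mod_cast (hr k).1
  have h2 : (r k : ℝ) < 2 ^ lvl k := by exact_mod_cast (hr k).2
  refine ⟨mul_pos h1 (hmesh_pos lvl k), ?_⟩
  simp only [gridpt, hmesh]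
  rw [← div_eq_mul_inv, div_lt_one (by positivity)]
  exact h2

/-- Central difference Laplacian of a grid function. -/
noncomputable def gridLaplacian (lvl : Fin d → ℕ) (W : (Fin d → ℕ) → ℝ) (r : Fin d → ℕ) : ℝ :=
  ∑ k, (W (update r k (r k + 1)) - 2 * W r + W (update r k (r k - 1))) / hmesh d lvl k ^ 2

lemma gridLaplacian_sub (lvl : Fin d → ℕ) (V W : (Fin d → ℕ) → ℝ) (r : Fin d → ℕ) :
    gridLaplacian lvl (fun r => V r - W r) r = gridLaplacian lvl V r - gridLaplacian lvl W r := by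
  simp only [gridLaplacian, ← Finset.sum_sub_distrib]
  exact Finset.sum_congr rfl fun k _ => by ring

/-- One-sided stability of the discrete Dirichlet problem. -/
lemma le_of_lt_gridLaplacian (hd : 1 ≤ d) (lvl : Fin d → ℕ) {W : (Fin d → ℕ) → ℝ} {ρ : ℝ}
    (hρ : 0 ≤ ρ) (hb : ∀ r, IsGridIdx d lvl r → (∃ k, r k = 0 ∨ r k = 2 ^ lvl k) → W r ≤ 0)
    (hi : ∀ r : Fin d → ℕ, (∀ k, 1 ≤ r k ∧ r k < 2 ^ lvl k) → -ρ < gridLaplacian lvl W r) :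
    ∀ r, IsGridIdx d lvl r → W r ≤ ρ := by
  set j : Fin d := ⟨0, hd⟩
  set h := hmesh d lvl j with hh
  have hpos : 0 < h := hmesh_pos lvl j
  set φ : ℕ → ℝ := fun m => m * h * (1 - m * h) / 2 with hφ
  have hφ0 : ∀ r, IsGridIdx d lvl r → 0 ≤ φ (r j) ∧ φ (r j) ≤ 1 := by
    intro r hr
    have h0 : 0 ≤ (r j : ℝ) * h := by positivity
    have h1 : (r j : ℝ) * h ≤ 1 := mul_hmesh_le_one lvl (hr j)
    simp only [hφ]
    constructor
    · have := mul_nonneg h0 (sub_nonneg.2 h1)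
      linarith
    · nlinarith
  set G := Fintype.piFinset fun l : Fin d => Finset.range (2 ^ lvl l + 1) with hG
  have hmem : ∀ r, r ∈ G ↔ IsGridIdx d lvl r := by
    intro r
    simp [hG, Fintype.mem_piFinset, IsGridIdx]
  obtain ⟨r, hrG, hmax⟩ := Finset.exists_max_image G (fun r => W r - ρ * φ (r j))
    ⟨0, (hmem 0).2 fun k => Nat.zero_le _⟩
  have hr := (hmem r).1 hrG
  have hle : W r - ρ * φ (r j) ≤ 0 := by
    by_cases hbr : ∃ k, r k = 0 ∨ r k = 2 ^ lvl k
    · have := hb r hr hbr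
      have := mul_nonneg hρ (hφ0 r hr).1
      linarith
    · exfalso
      push Not at hbr
      have hint : ∀ k, 1 ≤ r k ∧ r k < 2 ^ lvl k := fun k =>
        ⟨Nat.one_le_iff_ne_zero.2 (hbr k).1, lt_of_le_of_ne (hr k) (hbr k).2⟩
      refine absurd (hi r hint) (not_lt.2 ?_)
      have hterm : ∀ k, (W (update r k (r k + 1)) - 2 * W r + W (update r k (r k - 1)))
          / hmesh d lvl k ^ 2 ≤ if k = j then -ρ else 0 := by
        intro k
        have hup : ∀ m ≤ 2 ^ lvl k, update r k m ∈ G := by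
          intro m hm
          rw [hmem]
          intro l
          by_cases hl : l = k
          · subst hl; simpa using hm
          · simpa [hl] using hr l
        have h1 := hmax _ (hup (r k + 1) (hint k).2)
        have h2 := hmax _ (hup (r k - 1) ((Nat.sub_le _ _).trans (hr k)))
        rw [div_le_iff₀ (pow_pos (hmesh_pos lvl k) 2)]
        split_ifs with hk
        · subst hk
          rw [update_self] at h1 h2
          have e : φ (r j + 1) + φ (r j - 1) - 2 * φ (r j) = -h ^ 2 := by
            simp only [hφ]
            rw [Nat.cast_sub (hint j).1]
            push_cast
            ring
          have e' : ρ * φ (r j + 1) + ρ * φ (r j - 1) - 2 * (ρ * φ (r j)) = -ρ * h ^ 2 := by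
            linear_combination ρ * e
          linarith
        · rw [update_of_ne (Ne.symm hk)] at h1 h2
          linarith
      refine (Finset.sum_le_sum fun k _ => hterm k).trans ?_
      simp
  intro r' hr'
  have h1 := hmax r' ((hmem r').2 hr')
  have h2 := mul_le_mul_of_nonneg_left (hφ0 r' hr').2 hρ
  linarith

/-- Stability of the discrete Dirichlet problem. -/
lemma abs_le_of_abs_gridLaplacian_le (hd : 1 ≤ d) (lvl : Fin d → ℕ) {W : (Fin d → ℕ) → ℝ} {ρ : ℝ}
    (hρ : 0 ≤ ρ) (hb : ∀ r, IsGridIdx d lvl r → (∃ k, r k = 0 ∨ r k = 2 ^ lvl k) → W r = 0)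
    (hi : ∀ r : Fin d → ℕ, (∀ k, 1 ≤ r k ∧ r k < 2 ^ lvl k) → |gridLaplacian lvl W r| ≤ ρ) :
    ∀ r, IsGridIdx d lvl r → |W r| ≤ ρ := by
  intro r hr
  refine le_of_forall_pos_le_add fun ε hε => abs_le.2 ⟨?_, ?_⟩
  · have := le_of_lt_gridLaplacian hd lvl (W := fun r => 0 - W r) (ρ := ρ + ε) (by linarith)
      (fun r hr hbr => by simp [hb r hr hbr])
      (fun r hr => by
        have h0 : gridLaplacian lvl (fun _ => 0) r = 0 := by simp [gridLaplacian]
        rw [gridLaplacian_sub, h0]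
        linarith [(abs_le.1 (hi r hr)).2]) r hr
    linarith
  · exact le_of_lt_gridLaplacian hd lvl (ρ := ρ + ε) (by linarith)
      (fun r hr hbr => (hb r hr hbr).le)
      (fun r hr => by linarith [(abs_le.1 (hi r hr)).1]) r hr

lemma isFDPoisson_unique (hd : 1 ≤ d) (lvl : Fin d → ℕ) {f : (Fin d → ℝ) → ℝ}
    {U V : (Fin d → ℕ) → ℝ} (hU : IsFDPoisson d lvl f U) (hV : IsFDPoisson d lvl f V)
    {r : Fin d → ℕ} (hr : IsGridIdx d lvl r) : U r = V r := by
  have := abs_le_of_abs_gridLaplacian_le hd lvl (W := fun r => U r - V r) le_rfl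
    (fun r hr hbr => by simp [hU.1 r hr hbr, hV.1 r hr hbr])
    (fun r hr => by
      rw [gridLaplacian_sub]
      exact (abs_eq_zero.2 (sub_eq_zero.2 ((hU.2 r hr).trans (hV.2 r hr).symm))).le) r hr
  exact sub_eq_zero.1 (abs_eq_zero.1 (le_antisymm this (abs_nonneg _)))

lemma isFDPoisson_abs_sub_le (hd : 1 ≤ d) {f u : (Fin d → ℝ) → ℝ} (hu : MemX d 4 u)
    (heq : ∀ x ∈ openCube d, ∑ i, pd d i (pd d i u) x = f x) (hzero : ∀ x ∈ cubeBdry d, u x = 0)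
    {K : ℝ} (hK : ∀ α : Fin d → ℕ, (∀ i, α i ≤ 4) → ∀ x ∈ unitCube d, |mderiv d α u x| ≤ K)
    (lvl : Fin d → ℕ) {U : (Fin d → ℕ) → ℝ} (hU : IsFDPoisson d lvl f U)
    {r : Fin d → ℕ} (hr : IsGridIdx d lvl r) :
    |U r - u (gridpt d lvl r)| ≤ ∑ k, K * hmesh d lvl k ^ 2 / 12 := by
  have hK0 : 0 ≤ K := (abs_nonneg _).trans (hK 0 (fun _ => by simp) 0 ⟨le_rfl, fun _ => zero_le_one⟩)
  refine abs_le_of_abs_gridLaplacian_le hd lvl (W := fun r => U r - u (gridpt d lvl r))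
    (Finset.sum_nonneg fun k _ => by positivity) (fun r hr hbr => ?_) (fun r hr => ?_) r hr
  · obtain ⟨k, hk⟩ := hbr
    rw [hU.1 r hr ⟨k, hk⟩, hzero _ ⟨gridpt_mem_unitCube lvl hr, k, ?_⟩, sub_zero]
    rcases hk with hk | hk
    · exact Or.inl (by simp [gridpt, hk])
    · exact Or.inr (by simp [gridpt, hk, hmesh])
  · have hx := gridpt_mem_openCube lvl hr
    have hgrid : IsGridIdx d lvl r := fun k => (hr k).2.le
    have hxc := gridpt_mem_unitCube lvl hgrid
    have h1 : gridLaplacian lvl U r = ∑ k, pd d k (pd d k u) (gridpt d lvl r) := by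
      rw [heq _ hx]
      exact hU.2 r hr
    rw [gridLaplacian_sub, h1, gridLaplacian, ← Finset.sum_sub_distrib]
    refine (Finset.abs_sum_le_sum_abs _ _).trans (Finset.sum_le_sum fun k _ => ?_)
    have hpos := hmesh_pos lvl k
    have e1 : ((r k + 1 : ℕ) : ℝ) * hmesh d lvl k = gridpt d lvl r k + hmesh d lvl k := by
      simp only [gridpt]; push_cast; ring
    have e2 : ((r k - 1 : ℕ) : ℝ) * hmesh d lvl k = gridpt d lvl r k - hmesh d lvl k := by
      simp only [gridpt]; rw [Nat.cast_sub (hr k).1]; push_cast; ring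
    have b1 := mul_hmesh_le_one lvl (k := k) (m := r k + 1) (hr k).2
    have b2 : 0 ≤ ((r k - 1 : ℕ) : ℝ) * hmesh d lvl k := by positivity
    rw [e1] at b1
    rw [e2] at b2
    have := (derivChain_slice hu hK k hxc).abs_sndDiff_sub_le hpos b2 b1
    have e0 : update (0 : Fin d → ℕ) k 0 = 0 := update_eq_self k 0
    rw [abs_sub_comm] at this
    simp only [sndDiff, e0, mderiv_zero, update_eq_self, mderiv_single_two] at this
    rw [gridpt_update, gridpt_update, e1, e2]
    exact this

/-- Linear interpolation weight of vertex `b ∈ {0, 1}` of a mesh cell. -/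
noncomputable def hatWeight (θ : ℝ) (b : ℕ) : ℝ := if b = 0 then 1 - θ else θ

/-- The grid index of the vertex `e` of the cell containing `x`. -/
noncomputable def vertex (lvl : Fin d → ℕ) (x : Fin d → ℝ) (e : Fin d → ℕ) (k : Fin d) : ℕ :=
  cell (2 ^ lvl k) (x k) + e k

lemma vertex_isGridIdx (lvl : Fin d → ℕ) (x : Fin d → ℝ) {e : Fin d → ℕ}
    (he : e ∈ Fintype.piFinset fun _ : Fin d => Finset.range 2) :
    IsGridIdx d lvl (vertex lvl x e) := by
  intro k
  have h1 := cell_lt (N := 2 ^ lvl k) (by positivity) (x k)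
  have h2 := Finset.mem_range.1 (Fintype.mem_piFinset.1 he k)
  simp only [vertex]
  omega

/-- Vertex formula for multilinear interpolants. -/
lemma isInterp_eq_sum {lvl : Fin d → ℕ} {U : (Fin d → ℕ) → ℝ} {g : (Fin d → ℝ) → ℝ}
    (hg : IsInterp d lvl U g) {x : Fin d → ℝ} (hx : x ∈ unitCube d) :
    g x = ∑ e ∈ Fintype.piFinset fun _ : Fin d => Finset.range 2,
      (∏ k, hatWeight (cellPos (2 ^ lvl k) (x k)) (e k)) * U (vertex lvl x e) := by
  obtain ⟨c, hc⟩ := hg.2 (fun k => cell (2 ^ lvl k) (x k)) fun k => cell_lt (by positivity) _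
  have hpos : ∀ k, cellPos (2 ^ lvl k) (x k) ∈ Icc (0 : ℝ) 1 := fun k =>
    cellPos_mem (by positivity) ⟨hx.1 k, hx.2 k⟩
  have hxk : ∀ k, x k = ((cell (2 ^ lvl k) (x k) : ℝ) + cellPos (2 ^ lvl k) (x k))
      * hmesh d lvl k := by
    intro k
    rw [cellPos, hmesh]
    push_cast
    field_simp
    ring
  have hgx := hc x fun k => by
    have h0 := (hmesh_pos lvl k).le
    obtain ⟨h1, h2⟩ := hpos k
    exact ⟨(mul_le_mul_of_nonneg_right (by linarith) h0).trans (hxk k).ge,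
      (hxk k).le.trans (mul_le_mul_of_nonneg_right (by linarith) h0)⟩
  have hgv : ∀ e ∈ Fintype.piFinset fun _ : Fin d => Finset.range 2,
      U (vertex lvl x e) = ∑ T : Finset (Fin d), c T * ∏ k ∈ T, gridpt d lvl (vertex lvl x e) k := by
    intro e he
    rw [← hg.1 _ (vertex_isGridIdx lvl x he)]
    refine hc _ fun k => ?_
    have h2 : e k ≤ 1 := Nat.lt_succ_iff.1 (Finset.mem_range.1 (Fintype.mem_piFinset.1 he k))
    have h2' : (e k : ℝ) ≤ 1 := by exact_mod_cast h2
    have h3 : (0 : ℝ) ≤ e k := Nat.cast_nonneg _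
    have := (hmesh_pos lvl k).le
    simp only [gridpt, vertex]
    push_cast
    constructor <;> gcongr
    linarith
  have hswap := Finset.sum_congr rfl fun e he =>
    congrArg (fun y => (∏ k, hatWeight (cellPos (2 ^ lvl k) (x k)) (e k)) * y) (hgv e he)
  rw [hgx, hswap]
  simp only [Finset.mul_sum]
  rw [Finset.sum_comm]
  refine Finset.sum_congr rfl fun T _ => ?_
  have key : ∀ k, x k = ∑ b ∈ Finset.range 2, hatWeight (cellPos (2 ^ lvl k) (x k)) b
      * (((cell (2 ^ lvl k) (x k) + b : ℕ) : ℝ) * hmesh d lvl k) := by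
    intro k
    simp only [Finset.sum_range_succ, Finset.sum_range_zero, hatWeight]
    conv_lhs => rw [hxk k]
    push_cast
    simp
    ring
  have hone : ∀ k, ∑ b ∈ Finset.range 2, hatWeight (cellPos (2 ^ lvl k) (x k)) b = 1 := by
    intro k
    simp [Finset.sum_range_succ, hatWeight]
  have hprod : ∏ k ∈ T, x k = ∏ k, ∑ b ∈ Finset.range 2,
      hatWeight (cellPos (2 ^ lvl k) (x k)) b
        * (if k ∈ T then ((cell (2 ^ lvl k) (x k) + b : ℕ) : ℝ) * hmesh d lvl k else 1) := by
    rw [← Finset.prod_subset (Finset.subset_univ T) fun k _ hk => by simp [hk, hone]]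
    refine Finset.prod_congr rfl fun k hk => ?_
    simp only [hk, if_true]
    exact key k
  rw [hprod, Finset.prod_univ_sum, Finset.mul_sum]
  refine Finset.sum_congr rfl fun e _ => ?_
  rw [Finset.prod_mul_distrib, Finset.prod_ite_mem, Finset.univ_inter]
  simp only [gridpt, vertex]
  ring

lemma interp_eq_integral_heat (hd : 1 ≤ d) {lvl : Fin d → ℕ} {f : (Fin d → ℝ) → ℝ}
    {U : (Fin d → ℕ) → ℝ} (hU : IsFDPoisson d lvl f U) {g : (Fin d → ℝ) → ℝ}
    (hg : IsInterp d lvl U g) {x : Fin d → ℝ} (hx : x ∈ unitCube d) :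
    g x = -∫ t in Ioi (0 : ℝ), heat lvl f (fun l => coef (2 ^ lvl l) (x l)) t := by
  have hint := fun c => integrableOn_heat hd lvl f c
  rw [isInterp_eq_sum hg hx, Finset.sum_congr rfl fun e he => by
    rw [isFDPoisson_unique hd lvl hU (isFDPoisson_integral_heat hd lvl f)
      (vertex_isGridIdx lvl x he), mul_neg, ← integral_const_mul]]
  rw [Finset.sum_neg_distrib, ← integral_finsetSum _ fun e _ => (hint _).const_mul _]
  congr 2
  funext t
  simp only [heat, Finset.mul_sum]
  rw [Finset.sum_comm]
  refine Finset.sum_congr rfl fun s _ => ?_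
  have h1 : ∀ l, wt (2 ^ lvl l) (coef (2 ^ lvl l) (x l)) t (s l)
      = ∑ b ∈ Finset.range 2, hatWeight (cellPos (2 ^ lvl l) (x l)) b
        * wt (2 ^ lvl l) (nodeCoef (2 ^ lvl l) (cell (2 ^ lvl l) (x l) + b)) t (s l) := by
    intro l
    simp only [wt, Finset.mul_sum]
    rw [Finset.sum_comm]
    refine Finset.sum_congr rfl fun q _ => ?_
    simp only [Finset.sum_range_succ, Finset.sum_range_zero, hatWeight, nodeCoef, coef]
    simp
    ring
  simp only [h1]
  rw [Finset.prod_univ_sum, Finset.sum_mul]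
  refine Finset.sum_congr rfl fun e _ => ?_
  rw [Finset.prod_mul_distrib, mul_assoc]
  rfl

lemma tendsto_interp (hd : 1 ≤ d) {f u : (Fin d → ℝ) → ℝ} (hu : MemX d 4 u)
    (heq : ∀ x ∈ openCube d, ∑ i, pd d i (pd d i u) x = f x) (hzero : ∀ x ∈ cubeBdry d, u x = 0)
    {K : ℝ} (hK : ∀ α : Fin d → ℕ, (∀ i, α i ≤ 4) → ∀ x ∈ unitCube d, |mderiv d α u x| ≤ K)
    {sol : (Fin d → ℕ) → (Fin d → ℝ) → ℝ}
    (hsol : ∀ lvl : Fin d → ℕ, ∃ U : (Fin d → ℕ) → ℝ,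
      IsFDPoisson d lvl f U ∧ IsInterp d lvl U (sol lvl)) {x : Fin d → ℝ} (hx : x ∈ unitCube d) :
    Tendsto (fun M : ℕ => sol (fun _ => M) x) atTop (𝓝 (u x)) := by
  have hcont : ContinuousWithinAt u (unitCube d) x := by
    have := (hu.2 0 (fun _ => by simp)).1 x hx
    rwa [mderiv_zero] at this
  have hh : Tendsto (fun M : ℕ => ((2 : ℝ) ^ M)⁻¹) atTop (𝓝 0) := by
    have := tendsto_pow_atTop_nhds_zero_of_lt_one (r := (2 : ℝ)⁻¹) (by norm_num) (by norm_num)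
    simpa [inv_pow] using this
  have hh2 : Tendsto (fun M : ℕ => ∑ _k : Fin d, K * ((2 : ℝ) ^ M)⁻¹ ^ 2 / 12) atTop (𝓝 0) := by
    have hc : Continuous fun h : ℝ => ∑ _k : Fin d, K * h ^ 2 / 12 := by fun_prop
    have := (hc.tendsto 0).comp hh
    simpa only [Function.comp_def, ne_eq, OfNat.ofNat_ne_zero, not_false_eq_true, zero_pow,
      mul_zero, zero_div, Finset.sum_const_zero] using this
  rw [Metric.tendsto_atTop']
  intro ε hε
  obtain ⟨δ, hδ, hδu⟩ := Metric.continuousWithinAt_iff.1 hcont (ε / 4) (by positivity)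
  have hev := (hh.eventually_lt_const hδ).and
    (hh2.eventually_lt_const (show (0 : ℝ) < ε / 4 by positivity))
  obtain ⟨M₀, hM₀⟩ := eventually_atTop.1 hev
  refine ⟨M₀, fun M hM => ?_⟩
  obtain ⟨h1, h2⟩ := hM₀ M hM.le
  set lvl : Fin d → ℕ := fun _ => M with hlvl
  obtain ⟨U, hU, hI⟩ := hsol lvl
  have hpos : ∀ k, cellPos (2 ^ lvl k) (x k) ∈ Icc (0 : ℝ) 1 := fun k =>
    cellPos_mem (by positivity) ⟨hx.1 k, hx.2 k⟩
  have hvert : ∀ e ∈ Fintype.piFinset fun _ : Fin d => Finset.range 2,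
      |U (vertex lvl x e) - u x| ≤ ε / 2 := by
    intro e he
    have hgr := vertex_isGridIdx lvl x he
    have b1 := isFDPoisson_abs_sub_le hd hu heq hzero hK lvl hU hgr
    have b2 := hδu (gridpt_mem_unitCube lvl hgr) <| by
      refine lt_of_le_of_lt ((dist_pi_le_iff (by positivity)).2 fun k => ?_) h1
      have h3 : e k ≤ 1 := Nat.lt_succ_iff.1 (Finset.mem_range.1 (Fintype.mem_piFinset.1 he k))
      have h3' : (e k : ℝ) ≤ 1 := by exact_mod_cast h3
      have h4 : (0 : ℝ) ≤ e k := Nat.cast_nonneg _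
      have h5 := hpos k
      have e1 : gridpt d lvl (vertex lvl x e) k - x k
          = ((e k : ℝ) - cellPos (2 ^ lvl k) (x k)) * ((2 : ℝ) ^ M)⁻¹ := by
        simp only [gridpt, vertex, cellPos, hmesh, hlvl]
        push_cast
        field_simp
        ring
      rw [Real.dist_eq, e1, abs_mul, abs_of_pos (a := ((2 : ℝ) ^ M)⁻¹) (by positivity)]
      refine mul_le_of_le_one_left (by positivity) (abs_le.2 ⟨?_, ?_⟩) <;> linarith [h5.1, h5.2]
    rw [Real.dist_eq] at b2
    simp only [hmesh, hlvl] at b1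
    calc |U (vertex lvl x e) - u x|
        ≤ |U (vertex lvl x e) - u (gridpt d lvl (vertex lvl x e))|
          + |u (gridpt d lvl (vertex lvl x e)) - u x| := abs_sub_le _ _ _
      _ ≤ ε / 2 := by linarith
  have hone : ∑ e ∈ Fintype.piFinset fun _ : Fin d => Finset.range 2,
      ∏ k, hatWeight (cellPos (2 ^ lvl k) (x k)) (e k) = 1 := by
    rw [← Finset.prod_univ_sum]
    refine Finset.prod_eq_one fun k _ => ?_
    simp [Finset.sum_range_succ, hatWeight]
  have hnn : ∀ e : Fin d → ℕ, 0 ≤ ∏ k, hatWeight (cellPos (2 ^ lvl k) (x k)) (e k) := by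
    refine fun e => Finset.prod_nonneg fun k _ => ?_
    unfold hatWeight
    split_ifs
    · linarith [(hpos k).2]
    · exact (hpos k).1
  have hsub : sol lvl x - u x = ∑ e ∈ Fintype.piFinset fun _ : Fin d => Finset.range 2,
      (∏ k, hatWeight (cellPos (2 ^ lvl k) (x k)) (e k)) * (U (vertex lvl x e) - u x) := by
    simp only [mul_sub]
    rw [isInterp_eq_sum hI hx, Finset.sum_sub_distrib, ← Finset.sum_mul, hone, one_mul]
  have hle : |sol lvl x - u x| ≤ 1 * (ε / 2) := by
    rw [hsub, ← hone, Finset.sum_mul]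
    refine (Finset.abs_sum_le_sum_abs _ _).trans (Finset.sum_le_sum fun e he => ?_)
    rw [abs_mul, abs_of_nonneg (hnn e)]
    exact mul_le_mul_of_nonneg_left (hvert e he) (hnn e)
  rw [Real.dist_eq]
  linarith

end PoissonSparseGrid

namespace PoissonSparseGrid

open Set Function Filter Topology Real MeasureTheory

variable {d : ℕ}

/-- Hierarchical surplus, at level `i`, of the heat flow evaluated at `x`, on the mesh of level `M`. -/
noncomputable def surplus (M : ℕ) (f : (Fin d → ℝ) → ℝ) (x : Fin d → ℝ) (i : Fin d → ℕ) (t : ℝ) :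
    ℝ :=
  ∑ s ∈ Fintype.piFinset fun _ : Fin d => pts (2 ^ M),
    (∏ l, bdiff (lw (x l) t (s l)) (i l)) * f s

lemma heat_eq_sum_lw {M : ℕ} {i : Fin d → ℕ} (hi : ∀ l, i l ≤ M) (f : (Fin d → ℝ) → ℝ)
    (x : Fin d → ℝ) (t : ℝ) :
    heat i f (fun l => coef (2 ^ i l) (x l)) t
      = ∑ s ∈ Fintype.piFinset fun _ : Fin d => pts (2 ^ M),
        (∏ l, lw (x l) t (s l) (i l)) * f s := by
  have hsub : (Fintype.piFinset fun l => pts (2 ^ i l))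
      ⊆ Fintype.piFinset fun _ : Fin d => pts (2 ^ M) :=
    Fintype.piFinset_subset _ _ fun l => pts_two_pow_subset (hi l)
  rw [heat, ← Finset.sum_subset hsub]
  · refine Finset.sum_congr rfl fun s hs => ?_
    congr 1
    refine Finset.prod_congr rfl fun l _ => ?_
    rw [lw, if_pos (Fintype.mem_piFinset.1 hs l)]
  · intro s _ hs
    rw [Fintype.mem_piFinset, not_forall] at hs
    obtain ⟨l, hl⟩ := hs
    rw [Finset.prod_eq_zero (Finset.mem_univ l), zero_mul]
    rw [lw, if_neg hl]

lemma prod_sub_combination_eq {n M : ℕ} (hd : 1 ≤ d) (hn : d - 1 ≤ n) (hM : n ≤ M)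
    (a : Fin d → ℕ → ℝ) :
    ∏ l, a l M - ∑ k ∈ Finset.range d, (-1 : ℝ) ^ k * (Nat.choose (d - 1) k : ℝ) *
        ∑ i ∈ levels d n (n - k), ∏ l, a l (i l)
      = ∑ m ∈ Finset.Ico (n + 1) (d * M + 1), ∑ i ∈ levels d M m, ∏ l, bdiff (a l) (i l) := by
  have h1 : n + 1 ≤ d * M + 1 := by nlinarith
  rw [combination_formula d n hd hn, Finset.sum_Ico_eq_sub _ h1, ← sum_box_split,
    ← Finset.prod_univ_sum]
  simp only [sum_range_bdiff]
  congr 1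
  refine Finset.sum_congr rfl fun m hm => ?_
  rw [levels_mono_eq d n M m (Nat.lt_succ_iff.1 (Finset.mem_range.1 hm)) hM]

lemma le_of_mem_levels {M m : ℕ} {i : Fin d → ℕ} (hi : i ∈ levels d M m) (l : Fin d) : i l ≤ M :=
  Nat.lt_succ_iff.1 (Finset.mem_range.1 (Fintype.mem_piFinset.1 (Finset.mem_filter.1 hi).1 l))

lemma heat_sub_combination_eq {n M : ℕ} (hd : 1 ≤ d) (hn : d - 1 ≤ n) (hM : n ≤ M)
    (f : (Fin d → ℝ) → ℝ) (x : Fin d → ℝ) (t : ℝ) :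
    heat (fun _ => M) f (fun l => coef (2 ^ M) (x l)) t
      - ∑ k ∈ Finset.range d, (-1 : ℝ) ^ k * (Nat.choose (d - 1) k : ℝ) *
        ∑ i ∈ levels d n (n - k), heat i f (fun l => coef (2 ^ i l) (x l)) t
      = ∑ m ∈ Finset.Ico (n + 1) (d * M + 1), ∑ i ∈ levels d M m, surplus M f x i t := by
  have e : ∀ k, ∑ i ∈ levels d n (n - k), heat i f (fun l => coef (2 ^ i l) (x l)) t
      = ∑ s ∈ Fintype.piFinset fun _ : Fin d => pts (2 ^ M),
        (∑ i ∈ levels d n (n - k), ∏ l, lw (x l) t (s l) (i l)) * f s := by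
    intro k
    simp only [Finset.sum_mul]
    rw [Finset.sum_comm]
    exact Finset.sum_congr rfl fun i hi =>
      heat_eq_sum_lw (fun l => (le_of_mem_levels hi l).trans hM) f x t
  have e' : ∀ m, ∑ i ∈ levels d M m, surplus M f x i t
      = ∑ s ∈ Fintype.piFinset fun _ : Fin d => pts (2 ^ M),
        (∑ i ∈ levels d M m, ∏ l, bdiff (lw (x l) t (s l)) (i l)) * f s := by
    intro k
    simp only [surplus, Finset.sum_mul]
    rw [Finset.sum_comm]
  rw [heat_eq_sum_lw (M := M) (fun _ => le_rfl)]
  simp only [e, e', Finset.mul_sum]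
  rw [Finset.sum_comm, ← Finset.sum_sub_distrib, Finset.sum_comm (s := Finset.Ico _ _)]
  refine Finset.sum_congr rfl fun s _ => ?_
  simp only [← mul_assoc]
  rw [← Finset.sum_mul, ← Finset.sum_mul, ← sub_mul,
    ← prod_sub_combination_eq hd hn hM fun l => lw (x l) t (s l)]

lemma abs_surplus_le {f u : (Fin d → ℝ) → ℝ} (hu : MemX d 4 u)
    (heq : ∀ x ∈ openCube d, ∑ i, pd d i (pd d i u) x = f x)
    {K : ℝ} (hK : ∀ α : Fin d → ℕ, (∀ i, α i ≤ 4) → ∀ x ∈ unitCube d, |mderiv d α u x| ≤ K)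
    {x : Fin d → ℝ} (hx : x ∈ unitCube d) {M : ℕ} {i : Fin d → ℕ} (hi : ∀ l, i l ≤ M) {t : ℝ}
    (ht : 0 ≤ t) :
    |surplus M f x i t| ≤ ∑ j, (∏ l ∈ Finset.univ.erase j, 16 * ((4 : ℝ) ^ i l)⁻¹)
      * sndBound (i j) t * K := by
  have hxl : ∀ l, x l ∈ Icc (0 : ℝ) 1 := fun l => ⟨hx.1 l, hx.2 l⟩
  have e : surplus M f x i t = ∑ j, ∑ s ∈ Fintype.piFinset fun _ : Fin d => pts (2 ^ M),
      (∏ l, bdiff (lw (x l) t (s l)) (i l)) * pd d j (pd d j u) s := by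
    rw [surplus, Finset.sum_comm]
    refine Finset.sum_congr rfl fun s hs => ?_
    rw [← heq s fun l _ => mem_Ioo_of_mem_pts (Fintype.mem_piFinset.1 hs l), Finset.mul_sum]
  rw [e]
  refine (Finset.abs_sum_le_sum_abs _ _).trans (Finset.sum_le_sum fun j _ => ?_)
  exact abs_tensor_snd_le (w := fun l s => bdiff (lw (x l) t s) (i l)) hu hK
    (fun l s hs => mem_Ioo_of_mem_pts hs)
    (fun l _ _ hG => hG.abs_sum_bdiff_zero_le (hi l) ht (hxl l)) j
    (fun _ _ hG => hG.abs_sum_bdiff_two_le (hi j) ht (hxl j))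

lemma integral_surplus_bound_le {K : ℝ} (hK : 0 ≤ K) {M m : ℕ} {i : Fin d → ℕ}
    (hi : i ∈ levels d M m) :
    ∫ t in Ioi (0 : ℝ), ∑ j, (∏ l ∈ Finset.univ.erase j, 16 * ((4 : ℝ) ^ i l)⁻¹)
      * sndBound (i j) t * K ≤ d * (16 ^ (d - 1) * 20 * K) * ((4 : ℝ) ^ m)⁻¹ := by
  rw [integral_finsetSum _ fun j _ => ((integrableOn_sndBound (i j)).const_mul _).mul_const K]
  have h : ∀ j : Fin d, ∫ t in Ioi (0 : ℝ), (∏ l ∈ Finset.univ.erase j, 16 * ((4 : ℝ) ^ i l)⁻¹)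
      * sndBound (i j) t * K ≤ 16 ^ (d - 1) * 20 * K * ((4 : ℝ) ^ m)⁻¹ := by
    intro j
    rw [integral_mul_const, integral_const_mul]
    have h1 := integral_sndBound_le (i j)
    have h2 : ((4 : ℝ) ^ m)⁻¹ = (∏ l ∈ Finset.univ.erase j, ((4 : ℝ) ^ i l)⁻¹)
        * ((4 : ℝ) ^ i j)⁻¹ := by
      rw [Finset.prod_erase_mul _ _ (Finset.mem_univ j), ← (Finset.mem_filter.1 hi).2,
        ← Finset.prod_pow_eq_pow_sum, Finset.prod_inv_distrib]
    rw [Finset.prod_mul_distrib, Finset.prod_const, Finset.card_erase_of_mem (Finset.mem_univ j),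
      Finset.card_univ, Fintype.card_fin, h2]
    have h3 : (0 : ℝ) ≤ ∏ l ∈ Finset.univ.erase j, ((4 : ℝ) ^ i l)⁻¹ :=
      Finset.prod_nonneg fun l _ => by positivity
    calc _ ≤ 16 ^ (d - 1) * (∏ l ∈ Finset.univ.erase j, ((4 : ℝ) ^ i l)⁻¹)
          * (20 * ((4 : ℝ) ^ i j)⁻¹) * K := by gcongr
      _ = _ := by ring
  refine (Finset.sum_le_sum fun j _ => h j).trans (le_of_eq ?_)
  rw [Finset.sum_const, Finset.card_univ, Fintype.card_fin, nsmul_eq_mul]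
  ring

/-- Distance of the combination solution from the full grid solution of level `M`. -/
lemma abs_fullGrid_sub_combination_le {f u : (Fin d → ℝ) → ℝ} (hd : 1 ≤ d) (hu : MemX d 4 u)
    (heq : ∀ x ∈ openCube d, ∑ i, pd d i (pd d i u) x = f x)
    {K : ℝ} (hK : ∀ α : Fin d → ℕ, (∀ i, α i ≤ 4) → ∀ x ∈ unitCube d, |mderiv d α u x| ≤ K)
    {sol : (Fin d → ℕ) → (Fin d → ℝ) → ℝ}
    (hsol : ∀ lvl : Fin d → ℕ, ∃ U : (Fin d → ℕ) → ℝ,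
      IsFDPoisson d lvl f U ∧ IsInterp d lvl U (sol lvl))
    {n M : ℕ} (hn : d - 1 ≤ n) (hM : n ≤ M) {x : Fin d → ℝ} (hx : x ∈ unitCube d) :
    |sol (fun _ => M) x - ∑ k ∈ Finset.range d, (-1 : ℝ) ^ k * (Nat.choose (d - 1) k : ℝ) *
        ∑ i ∈ levels d n (n - k), sol i x|
      ≤ 121000 * K * (d : ℝ) * (5 / 2 : ℝ) ^ d *
        ((n : ℝ) + 2 * ((d : ℝ) - 1)) ^ (d - 1) * ((4 : ℝ) ^ n)⁻¹ := by
  have hK0 : 0 ≤ K := (abs_nonneg _).trans (hK 0 (fun _ => by simp) 0 ⟨le_rfl, fun _ => zero_le_one⟩)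
  have hint := fun (i : Fin d → ℕ) (c : Fin d → ℕ → ℝ) => integrableOn_heat hd i f c
  have hrep : ∀ i, sol i x = -∫ t in Ioi (0 : ℝ), heat i f (fun l => coef (2 ^ i l) (x l)) t := by
    intro i
    obtain ⟨U, hU, hI⟩ := hsol i
    exact interp_eq_integral_heat hd hU hI hx
  have hcomb : sol (fun _ => M) x - ∑ k ∈ Finset.range d, (-1 : ℝ) ^ k *
        (Nat.choose (d - 1) k : ℝ) * ∑ i ∈ levels d n (n - k), sol i x
      = -∫ t in Ioi (0 : ℝ), ∑ m ∈ Finset.Ico (n + 1) (d * M + 1), ∑ i ∈ levels d M m,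
        surplus M f x i t := by
    simp only [← heat_sub_combination_eq hd hn hM]
    have hi1 : ∀ k, IntegrableOn (fun t => ∑ i ∈ levels d n (n - k),
        heat i f (fun l => coef (2 ^ i l) (x l)) t) (Ioi 0) :=
      fun k => integrable_finsetSum _ fun i _ => hint i _
    rw [integral_sub (hint _ _) (integrable_finsetSum _ fun k _ => (hi1 k).const_mul _),
      integral_finsetSum _ fun k _ => (hi1 k).const_mul _, neg_sub',
      ← Finset.sum_neg_distrib, hrep]
    congr 1
    refine Finset.sum_congr rfl fun k _ => ?_
    rw [integral_const_mul, integral_finsetSum (levels d n (n - k)) fun i _ => hint i _, ← mul_neg,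
      ← Finset.sum_neg_distrib]
    simp only [hrep]
  have hbi : ∀ i : Fin d → ℕ, IntegrableOn (fun t => ∑ j, (∏ l ∈ Finset.univ.erase j,
      16 * ((4 : ℝ) ^ i l)⁻¹) * sndBound (i j) t * K) (Ioi 0) := fun i =>
    integrable_finsetSum _ fun j _ => ((integrableOn_sndBound (i j)).const_mul _).mul_const K
  have hbi' : ∀ m, IntegrableOn (fun t => ∑ i ∈ levels d M m, ∑ j, (∏ l ∈ Finset.univ.erase j,
      16 * ((4 : ℝ) ^ i l)⁻¹) * sndBound (i j) t * K) (Ioi 0) := fun m =>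
    integrable_finsetSum _ fun i _ => hbi i
  have hbound : |∫ t in Ioi (0 : ℝ), ∑ m ∈ Finset.Ico (n + 1) (d * M + 1), ∑ i ∈ levels d M m,
        surplus M f x i t|
      ≤ ∫ t in Ioi (0 : ℝ), ∑ m ∈ Finset.Ico (n + 1) (d * M + 1), ∑ i ∈ levels d M m,
        ∑ j, (∏ l ∈ Finset.univ.erase j, 16 * ((4 : ℝ) ^ i l)⁻¹) * sndBound (i j) t * K := by
    rw [← Real.norm_eq_abs]
    refine norm_integral_le_of_norm_le (integrable_finsetSum _ fun m _ => hbi' m) ?_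
    filter_upwards [ae_restrict_mem measurableSet_Ioi] with t ht
    refine (Finset.abs_sum_le_sum_abs _ _).trans (Finset.sum_le_sum fun m _ => ?_)
    refine (Finset.abs_sum_le_sum_abs _ _).trans (Finset.sum_le_sum fun i hi => ?_)
    exact abs_surplus_le hu heq hK hx (le_of_mem_levels hi) ht.le
  rw [hcomb, abs_neg]
  refine hbound.trans ?_
  rw [integral_finsetSum _ fun m _ => hbi' m]
  calc ∑ m ∈ Finset.Ico (n + 1) (d * M + 1), ∫ t in Ioi (0 : ℝ), ∑ i ∈ levels d M m,
        ∑ j, (∏ l ∈ Finset.univ.erase j, 16 * ((4 : ℝ) ^ i l)⁻¹) * sndBound (i j) t * K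
      ≤ ∑ m ∈ Finset.Ico (n + 1) (d * M + 1), ∑ _i ∈ levels d M m,
        d * (16 ^ (d - 1) * 20 * K) * ((4 : ℝ) ^ m)⁻¹ := by
        refine Finset.sum_le_sum fun m _ => ?_
        rw [integral_finsetSum _ fun i _ => hbi i]
        exact Finset.sum_le_sum fun i hi => integral_surplus_bound_le hK0 hi
    _ = d * (16 ^ (d - 1) * 20 * K) * ∑ m ∈ Finset.Ico (n + 1) (d * M + 1),
        ∑ _i ∈ levels d M m, ((4 : ℝ) ^ m)⁻¹ := by simp only [Finset.mul_sum]
    _ ≤ d * (16 ^ (d - 1) * 20 * K) * (((n : ℝ) + 2 * ((d : ℝ) - 1)) ^ (d - 1)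
        / ((d - 1).factorial : ℝ) * ((4 : ℝ) ^ n)⁻¹) := by
        gcongr
        exact tail_sum_le d n M hd hn _
    _ = K * d * ((n : ℝ) + 2 * ((d : ℝ) - 1)) ^ (d - 1) * ((4 : ℝ) ^ n)⁻¹
        * ((16 : ℝ) ^ (d - 1) * 20 / ((d - 1).factorial : ℝ)) := by ring
    _ ≤ K * d * ((n : ℝ) + 2 * ((d : ℝ) - 1)) ^ (d - 1) * ((4 : ℝ) ^ n)⁻¹
        * (121000 * (5 / 2 : ℝ) ^ d) := by
        have hd' : (0 : ℝ) ≤ (d : ℝ) - 1 := by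
          have : (1 : ℝ) ≤ d := by exact_mod_cast hd
          linarith
        gcongr
        exact pow_div_factorial_const_le d hd
    _ = _ := by ring

end PoissonSparseGrid

/-- Sparse grid combination technique error bound for the Poisson equation
(final Poisson theorem): for `u ∈ X_4^d` with `K = sup ‖D^α u‖_∞` and the
combination solution `u_n` built from interpolated central finite difference
solutions, `|u(x) - u_n(x)| ≤ 121000·K·d·(5/2)^d·(n+2(d-1))^{d-1}·4^{-n}`. -/
theorem poisson_sparse_grid_error_bound (d : ℕ) (hd : 1 ≤ d)
    (f u : (Fin d → ℝ) → ℝ) (hu : MemX d 4 u)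
    (heq : ∀ x ∈ openCube d, ∑ i, pd d i (pd d i u) x = f x)
    (hzero : ∀ x ∈ cubeBdry d, u x = 0)
    (K : ℝ)
    (hK : ∀ α : Fin d → ℕ, (∀ i, α i ≤ 4) → ∀ x ∈ unitCube d, |mderiv d α u x| ≤ K)
    (sol : (Fin d → ℕ) → (Fin d → ℝ) → ℝ)
    (hsol : ∀ lvl : Fin d → ℕ, ∃ U : (Fin d → ℕ) → ℝ,
      IsFDPoisson d lvl f U ∧ IsInterp d lvl U (sol lvl)) :
    ∀ n : ℕ, d - 1 ≤ n → ∀ x ∈ unitCube d,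
      |u x - ∑ k ∈ Finset.range d, (-1 : ℝ) ^ k * (Nat.choose (d - 1) k : ℝ) *
          ∑ i ∈ (Fintype.piFinset fun _ : Fin d => Finset.range (n + 1)).filter
              (fun i => ∑ j, i j = n - k),
            sol i x|
        ≤ 121000 * K * (d : ℝ) * (5 / 2 : ℝ) ^ d *
            ((n : ℝ) + 2 * ((d : ℝ) - 1)) ^ (d - 1) * ((4 : ℝ) ^ n)⁻¹ := by
  intro n hn x hx
  refine le_of_tendsto
    ((PoissonSparseGrid.tendsto_interp hd hu heq hzero hK hsol hx).sub_const _).abs ?_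
  filter_upwards [Filter.eventually_ge_atTop n] with M hM
  exact PoissonSparseGrid.abs_fullGrid_sub_combination_le hd hu heq hK hsol hn hM hx
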